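/- arXiv:2511.04826 — 4 statements merged into one kernel-verified Lean document; each statement's English description precedes it below -/
import Mathlib

section
/- Let G be a simple graph with at most m edges and with no cycle of length strictly less than ℓ, and let C be a cycle of G of length at most 1.01·ℓ. Then for every positive integer α, the number of cycles C' of G with C' ≠ C and |C' \ C| ≤ α·ℓ/4 is at most (2m)^{2α}, where cycles are identified with their edge sets. -/
/-- A finset of edges `C` is (the edge set of) a cycle of the simple graph `G`. -/
def IsCycleSet {V : Type*} [DecidableEq V] (G : SimpleGraph V) (C : Finset (Sym2 V)) : Prop :=
  ∃ (u : V) (w : G.Walk u u), w.IsCycle ∧ C = w.edges.toFinset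

open Finset
open scoped symmDiff

section CycleOverlap

variable {V : Type*} [DecidableEq V]

/-- The mod-two boundary of an edge: the indicator function of its endpoints. -/
def edgeBoundary (e : Sym2 V) : V → ZMod 2 := fun v => if v ∈ e then 1 else 0

lemma edgeBoundary_mk {a b : V} (h : a ≠ b) :
    edgeBoundary s(a, b) = Pi.single a 1 + Pi.single b 1 := by
  funext v
  simp only [edgeBoundary, Sym2.mem_iff, Pi.add_apply, Pi.single_apply]
  by_cases h1 : v = a <;> by_cases h2 : v = b <;> simp_all

omit [DecidableEq V] in
lemma add_self_eq_zero_of_zmod_two (x : V → ZMod 2) : x + x = 0 :=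
  funext fun v => CharTwo.add_self_eq_zero (x v)

omit [DecidableEq V] in
lemma neg_eq_self_of_zmod_two (x : V → ZMod 2) : -x = x :=
  neg_eq_of_add_eq_zero_left (add_self_eq_zero_of_zmod_two x)

omit [DecidableEq V] in
lemma sum_symmDiff_of_zmod_two {ι : Type*} [DecidableEq ι] (f : ι → V → ZMod 2)
    (A B : Finset ι) : ∑ e ∈ A ∆ B, f e = ∑ e ∈ A, f e + ∑ e ∈ B, f e := by
  have h : ∑ e ∈ A ∆ B, f e = ∑ e ∈ A \ B, f e + ∑ e ∈ B \ A, f e := by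
    rw [symmDiff_def, sup_eq_union, sum_union disjoint_sdiff_sdiff]
  rw [h, ← sum_inter_add_sum_sdiff A B f, ← sum_inter_add_sum_sdiff B A f, inter_comm B A]
  have := add_self_eq_zero_of_zmod_two (∑ e ∈ A ∩ B, f e)
  linear_combination (exp := 1) -this

/-- The group of mod-two boundaries of subsets of `C`. -/
def boundaries (C : Finset (Sym2 V)) : AddSubgroup (V → ZMod 2) where
  carrier := {x | ∃ J ⊆ C, ∑ e ∈ J, edgeBoundary e = x}
  zero_mem' := ⟨∅, empty_subset _, by simp⟩
  add_mem' := by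
    rintro _ _ ⟨J, hJ, rfl⟩ ⟨K, hK, rfl⟩
    refine ⟨J ∆ K, fun e he => ?_, sum_symmDiff_of_zmod_two _ _ _⟩
    rcases mem_symmDiff.1 he with h | h
    exacts [hJ h.1, hK h.1]
  neg_mem' := by
    rintro _ ⟨J, hJ, rfl⟩
    exact ⟨J, hJ, (neg_eq_self_of_zmod_two _).symm⟩

lemma mem_boundaries {C : Finset (Sym2 V)} {x : V → ZMod 2} :
    x ∈ boundaries C ↔ ∃ J ⊆ C, ∑ e ∈ J, edgeBoundary e = x := Iff.rfl

variable {G : SimpleGraph V}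

/-- A nonempty set of edges in which every vertex has even degree contains a cycle. -/
lemma exists_isCycleSet_subset_of_even [Fintype V] {F : Finset (Sym2 V)}
    (hF : ∀ e ∈ F, e ∈ G.edgeSet)
    (hne : F.Nonempty) (heven : ∑ e ∈ F, edgeBoundary e = 0) :
    ∃ D ⊆ F, IsCycleSet G D := by
  classical
  set H := SimpleGraph.fromEdgeSet (F : Set (Sym2 V)) with hH
  have hHG : H ≤ G := fun a b hab => hF s(a, b) (by simpa using hab.1)
  by_cases hac : H.IsAcyclic
  · exfalso
    obtain ⟨e, he⟩ := hne
    induction e using Sym2.ind with | _ a b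
    have hab : a ≠ b := (hF _ he : G.Adj a b).ne
    have hbridge := SimpleGraph.isAcyclic_iff_forall_isBridge.1 hac
      (show s(a, b) ∈ H.edgeSet from ⟨by simpa using he, hab⟩)
    rw [SimpleGraph.isBridge_iff] at hbridge
    set K := H \ SimpleGraph.fromEdgeSet {s(a, b)}
    let χ : V → ZMod 2 := fun v => if K.Reachable a v then 1 else 0
    have hsum (e : Sym2 V) (he : e ∈ F) :
        ∑ v, χ v * edgeBoundary e v = if e = s(a, b) then 1 else 0 := by
      induction e using Sym2.ind with | _ c d
      have hcd : G.Adj c d := hF _ he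
      have h1 : ∑ v, χ v * edgeBoundary s(c, d) v = χ c + χ d := by
        simp [edgeBoundary_mk hcd.ne, mul_add, sum_add_distrib, Pi.single_apply]
      rw [h1]
      split_ifs with h
      · have hnb : ¬ K.Reachable a b := hbridge
        have ha : χ a = 1 := if_pos (SimpleGraph.Reachable.refl a)
        have hb : χ b = 0 := if_neg hnb
        rcases Sym2.eq_iff.1 h with ⟨rfl, rfl⟩ | ⟨rfl, rfl⟩
        · rw [ha, hb, add_zero]
        · rw [ha, hb, zero_add]
      · have hadj : K.Adj c d := by
          refine ⟨⟨by simpa using he, hcd.ne⟩, fun h' => h (by simpa using h'.1)⟩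
        have : χ c = χ d := by
          have : K.Reachable a c ↔ K.Reachable a d :=
            ⟨fun h => h.trans hadj.reachable, fun h => h.trans hadj.symm.reachable⟩
          simp only [χ, this]
        rw [this, CharTwo.add_self_eq_zero]
    have h0 : ∑ v, χ v * (∑ e ∈ F, edgeBoundary e) v = 1 := by
      simp only [Finset.sum_apply, mul_sum]
      rw [sum_comm, sum_congr rfl hsum]
      simp [he]
    rw [heven] at h0
    simp at h0
  · simp only [SimpleGraph.IsAcyclic, not_forall, not_not] at hac
    obtain ⟨v, w, hw⟩ := hac
    refine ⟨w.edges.toFinset, fun e he => ?_, v, w.mapLe hHG, hw.mapLe hHG, by simp⟩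
    have := w.edges_subset_edgeSet (List.mem_toFinset.1 he)
    rw [hH, SimpleGraph.edgeSet_fromEdgeSet] at this
    exact_mod_cast this.1

/-- The boundary of a walk consists of its two ends, modulo `C`, for every initial part of the walk
that stops just before an edge outside `C`. -/
lemma sum_take_filter_darts_mem_boundaries (C : Finset (Sym2 V)) {u v : V} (w : G.Walk u v)
    (k : ℕ) :
    (((w.darts.filter (·.edge ∉ C)).take k).map fun d => edgeBoundary d.edge).sum +
      Pi.single u 1 +
      Pi.single ((((w.darts.filter (·.edge ∉ C))[k]?).map fun d => d.fst).getD v) 1 ∈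
      boundaries C := by
  induction w generalizing k with
  | nil =>
    simp [add_self_eq_zero_of_zmod_two]
  | @cons u x v h p ih =>
    have hb := edgeBoundary_mk h.ne
    by_cases hC : s(u, x) ∈ C
    · have hmem : edgeBoundary s(u, x) ∈ boundaries C :=
        mem_boundaries.2 ⟨{s(u, x)}, by simpa using hC, by simp⟩
      have hadd := (boundaries C).add_mem hmem (ih k)
      have hx := add_self_eq_zero_of_zmod_two (Pi.single x 1 : V → ZMod 2)
      have hf : (SimpleGraph.Walk.cons h p).darts.filter (·.edge ∉ C) =
          p.darts.filter (·.edge ∉ C) :=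
        List.filter_cons_of_neg fun h' => (of_decide_eq_true h' : s(u, x) ∉ C) hC
      rw [hf]
      convert hadd using 1
      rw [hb]
      linear_combination (exp := 1) -hx
    · have hf : (SimpleGraph.Walk.cons h p).darts.filter (·.edge ∉ C) =
          ⟨(u, x), h⟩ :: p.darts.filter (·.edge ∉ C) :=
        List.filter_cons_of_pos (decide_eq_true (p := s(u, x) ∉ C) hC)
      rw [hf]
      cases k with
      | zero => simp [add_self_eq_zero_of_zmod_two]
      | succ k =>
        have hu := add_self_eq_zero_of_zmod_two (Pi.single u 1 : V → ZMod 2)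
        have := ih k
        simp only [List.take_succ_cons, List.map_cons, List.sum_cons, List.getElem?_cons_succ]
        convert this using 1
        change edgeBoundary s(u, x) + _ + _ + _ = _
        rw [hb]
        linear_combination (exp := 1) hu

lemma IsCycleSet.mem_edgeSet {C : Finset (Sym2 V)} (hC : IsCycleSet G C) :
    ∀ e ∈ C, e ∈ G.edgeSet := by
  obtain ⟨u, w, -, rfl⟩ := hC
  exact fun e he => w.edges_subset_edgeSet (List.mem_toFinset.1 he)

lemma IsCycleSet.three_le_card {C : Finset (Sym2 V)} (hC : IsCycleSet G C) : 3 ≤ C.card := by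
  obtain ⟨u, w, hw, rfl⟩ := hC
  rw [List.toFinset_card_of_nodup hw.isTrail.edges_nodup, w.length_edges]
  exact hw.three_le_length

lemma IsCycleSet.sum_edgeBoundary {C : Finset (Sym2 V)} (hC : IsCycleSet G C) :
    ∑ e ∈ C, edgeBoundary e = 0 := by
  obtain ⟨u, w, hw, rfl⟩ := hC
  rw [List.sum_toFinset _ hw.isTrail.edges_nodup]
  obtain ⟨J, hJ, h⟩ := mem_boundaries.1 (sum_take_filter_darts_mem_boundaries ∅ w w.length)
  obtain rfl := subset_empty.1 hJ
  have hu := add_self_eq_zero_of_zmod_two (Pi.single u 1 : V → ZMod 2)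
  have hf : w.darts.filter (·.edge ∉ (∅ : Finset (Sym2 V))) = w.darts := by simp
  rw [hf, List.take_of_length_le (by simp), List.getElem?_eq_none (by simp), sum_empty,
    Option.map_none, Option.getD_none, add_assoc, hu, add_zero] at h
  rw [h, SimpleGraph.Walk.edges, List.map_map]
  rfl

/-- `L` lists the edges of `E`, oriented and ordered along a closed walk that uses in addition
only edges of `C`. -/
structure IsOffTrace (C E : Finset (Sym2 V)) (d : G.Dart) (L : List G.Dart) : Prop where
  nodup : (L.map SimpleGraph.Dart.edge).Nodup
  toFinset_eq : (L.map SimpleGraph.Dart.edge).toFinset = E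
  getD_zero : L.getD 0 d = d
  sum_take_mem (k : ℕ) : ((L.take k).map fun d => edgeBoundary d.edge).sum +
    Pi.single d.fst 1 + Pi.single (L.getD k d).fst 1 ∈ boundaries C

lemma IsOffTrace.length_eq {C E : Finset (Sym2 V)} {d : G.Dart} {L : List G.Dart}
    (h : IsOffTrace C E d L) : L.length = E.card := by
  rw [← h.toFinset_eq, List.toFinset_card_of_nodup h.nodup, List.length_map]

lemma IsCycleSet.exists_isOffTrace {C D : Finset (Sym2 V)} (hD : IsCycleSet G D)
    (hne : (D \ C).Nonempty) :
    ∃ (d : G.Dart) (L : List G.Dart), IsOffTrace C (D \ C) d L := by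
  obtain ⟨u, w, hw, rfl⟩ := hD
  have hmem := sum_take_filter_darts_mem_boundaries C w
  have hE : ((w.darts.filter (·.edge ∉ C)).map SimpleGraph.Dart.edge).toFinset =
      w.edges.toFinset \ C := by
    ext e
    simp only [SimpleGraph.Walk.edges, List.mem_toFinset, List.mem_map, List.mem_filter,
      mem_sdiff, decide_eq_true_eq]
    constructor
    · rintro ⟨d, ⟨h1, h2⟩, rfl⟩
      exact ⟨⟨d, h1, rfl⟩, h2⟩
    · rintro ⟨⟨d, h1, rfl⟩, h2⟩
      exact ⟨d, ⟨h1, h2⟩, rfl⟩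
  have hnodup : ((w.darts.filter (·.edge ∉ C)).map SimpleGraph.Dart.edge).Nodup :=
    (List.filter_sublist.map _).nodup hw.isTrail.edges_nodup
  generalize w.darts.filter (·.edge ∉ C) = L at hmem hE hnodup
  rw [← hE] at hne ⊢
  cases L with
  | nil => simp at hne
  | cons d L =>
    refine ⟨d, d :: L, hnodup, rfl, rfl, fun k => ?_⟩
    have hd : Pi.single u 1 + Pi.single d.fst 1 ∈ boundaries C := by simpa using hmem 0
    have hu := add_self_eq_zero_of_zmod_two (Pi.single u 1 : V → ZMod 2)
    rcases lt_or_ge k (d :: L).length with hk | hk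
    · have := (boundaries C).add_mem (hmem k) hd
      rw [List.getElem?_eq_getElem hk, Option.map_some, Option.getD_some] at this
      rw [List.getD_eq_getElem _ _ hk]
      convert this using 1
      linear_combination (exp := 1) -hu
    · have := hmem k
      rw [List.getElem?_eq_none hk, Option.map_none, Option.getD_none] at this
      rw [List.getD_eq_default _ _ hk]
      have hdd := add_self_eq_zero_of_zmod_two (Pi.single d.fst 1 : V → ZMod 2)
      convert this using 1
      linear_combination (exp := 1) hdd - hu

/-- A nonempty edge set closed modulo `C` is long, since it forms an even set both with some
subset of `C` and with the complement of that subset. -/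
lemma two_mul_le_of_sum_mem_boundaries [Fintype V] {ℓ : ℕ}
    (hgirth : ∀ C : Finset (Sym2 V), IsCycleSet G C → ℓ ≤ C.card)
    {C F : Finset (Sym2 V)} (hC : IsCycleSet G C) (hF : ∀ e ∈ F, e ∈ G.edgeSet)
    (hdisj : Disjoint F C) (hne : F.Nonempty)
    (hmem : ∑ e ∈ F, edgeBoundary e ∈ boundaries C) : 2 * ℓ ≤ 2 * F.card + C.card := by
  have key (J : Finset (Sym2 V)) (hJ : J ⊆ C)
      (h : ∑ e ∈ J, edgeBoundary e = ∑ e ∈ F, edgeBoundary e) : ℓ ≤ F.card + J.card := by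
    obtain ⟨D, hD, hDc⟩ := exists_isCycleSet_subset_of_even (G := G) (F := F ∪ J)
      (fun e he => (mem_union.1 he).elim (hF e) fun h => hC.mem_edgeSet e (hJ h))
      (hne.mono subset_union_left)
      (by rw [sum_union (hdisj.mono_right hJ), h, add_self_eq_zero_of_zmod_two])
    exact (hgirth D hDc).trans ((card_le_card hD).trans (card_union_le _ _))
  obtain ⟨J, hJ, h⟩ := mem_boundaries.1 hmem
  have h1 := key J hJ h
  have h2 := key (C \ J) sdiff_subset (by
    have h3 := sum_sdiff (f := edgeBoundary) hJ
    rw [hC.sum_edgeBoundary] at h3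
    rw [eq_neg_of_add_eq_zero_left h3, neg_eq_self_of_zmod_two, h])
  have := card_sdiff_add_card_eq_card hJ
  omega

/-- A set of edges off `C` is determined by every `s`-th dart of a trace of it. -/
lemma IsOffTrace.eq_of_sample_eq [Fintype V] {ℓ : ℕ}
    (hgirth : ∀ C : Finset (Sym2 V), IsCycleSet G C → ℓ ≤ C.card)
    {C E₁ E₂ : Finset (Sym2 V)} (hC : IsCycleSet G C) {s N : ℕ}
    (hs : 4 * s + C.card < 2 * ℓ + 4) (hs' : 2 * s + C.card < 2 * ℓ) (hN : 0 < N)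
    {d₁ d₂ : G.Dart} {L₁ L₂ : List G.Dart} (h₁ : IsOffTrace C E₁ d₁ L₁)
    (h₂ : IsOffTrace C E₂ d₂ L₂) (hE₁ : Disjoint E₁ C) (hE₂ : Disjoint E₂ C)
    (hc₁ : E₁.card ≤ N * s) (hc₂ : E₂.card ≤ N * s)
    (hsample : ∀ i < N, L₁.getD (i * s) d₁ = L₂.getD (i * s) d₂) : E₁ = E₂ := by
  obtain rfl : d₁ = d₂ := by
    simpa only [Nat.zero_mul, h₁.getD_zero, h₂.getD_zero] using hsample 0 hN
  have hl₁ := h₁.length_eq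
  have hl₂ := h₂.length_eq
  have hsample' (i : ℕ) (hi : i ≤ N) : L₁.getD (i * s) d₁ = L₂.getD (i * s) d₁ := by
    rcases hi.lt_or_eq with h | rfl
    · exact hsample i h
    · rw [List.getD_eq_default _ _ (by omega), List.getD_eq_default _ _ (by omega)]
  have hpre (i : ℕ) (hi : i ≤ N) :
      ((L₁.take (i * s)).map fun d => edgeBoundary d.edge).sum -
        ((L₂.take (i * s)).map fun d => edgeBoundary d.edge).sum ∈ boundaries C := by
    have := (boundaries C).sub_mem (h₁.sum_take_mem (i * s)) (h₂.sum_take_mem (i * s))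
    rw [hsample' i hi] at this
    convert this using 1
    abel
  let B (L : List G.Dart) (i : ℕ) : Finset (Sym2 V) :=
    (((L.drop (i * s)).take s).map SimpleGraph.Dart.edge).toFinset
  have hBsub (L : List G.Dart) (i : ℕ) : B L i ⊆ (L.map SimpleGraph.Dart.edge).toFinset := by
    intro e he
    simp only [B, List.mem_toFinset, List.mem_map] at he ⊢
    obtain ⟨d, hd, rfl⟩ := he
    exact ⟨d, List.mem_of_mem_drop (List.mem_of_mem_take hd), rfl⟩
  have hBcard (L : List G.Dart) (i : ℕ) : (B L i).card ≤ s :=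
    (List.toFinset_card_le _).trans (by simp)
  have hBhead (L : List G.Dart) (i : ℕ) (hi : i * s < L.length) (hs0 : 0 < s) :
      (L.getD (i * s) d₁).edge ∈ B L i := by
    rw [List.getD_eq_getElem _ _ hi]
    simp only [B, List.mem_toFinset, List.mem_map]
    refine ⟨_, ?_, rfl⟩
    rw [List.drop_eq_getElem_cons hi]
    exact List.mem_take_iff_getElem.2 ⟨0, by simp [hs0, hi], rfl⟩
  have hBempty (L : List G.Dart) (i : ℕ) (hi : L.length ≤ i * s) : B L i = ∅ := by
    simp only [B, List.drop_eq_nil_of_le hi, List.take_nil, List.map_nil, List.toFinset_nil]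
  have hBsum (L : List G.Dart) (hL : (L.map SimpleGraph.Dart.edge).Nodup) (i : ℕ) :
      ∑ e ∈ B L i, edgeBoundary e =
        ((L.take ((i + 1) * s)).map fun d => edgeBoundary d.edge).sum -
          ((L.take (i * s)).map fun d => edgeBoundary d.edge).sum := by
    rw [List.sum_toFinset _
      ((((List.take_sublist _ _).trans (List.drop_sublist _ _)).map _).nodup hL),
      Nat.succ_mul, List.take_add, List.map_append, List.sum_append, add_sub_cancel_left,
      List.map_map]
    rfl
  have hB (i : ℕ) (hi : i < N) : B L₁ i = B L₂ i := by
    by_contra hne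
    have hsub : B L₁ i ∆ B L₂ i ⊆ E₁ ∪ E₂ := by
      intro e he
      rcases mem_symmDiff.1 he with h | h
      · exact mem_union_left _ (h₁.toFinset_eq ▸ hBsub _ _ h.1)
      · exact mem_union_right _ (h₂.toFinset_eq ▸ hBsub _ _ h.1)
    have hG (e) (he : e ∈ B L₁ i ∆ B L₂ i) : e ∈ G.edgeSet := by
      rcases mem_symmDiff.1 he with h | h
      all_goals
        obtain ⟨d, -, rfl⟩ := List.mem_map.1 (List.mem_toFinset.1 h.1)
        exact d.edge_mem
    have hlong := two_mul_le_of_sum_mem_boundaries hgirth hC hG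
      ((disjoint_union_left.2 ⟨hE₁, hE₂⟩).mono_left hsub)
      (nonempty_iff_ne_empty.2 fun h => hne (symmDiff_eq_bot.1 h))
      (by
        rw [sum_symmDiff_of_zmod_two, ← neg_eq_self_of_zmod_two (∑ e ∈ B L₂ i, _),
          ← sub_eq_add_neg, hBsum _ h₁.nodup, hBsum _ h₂.nodup]
        convert (boundaries C).sub_mem (hpre (i + 1) hi) (hpre i hi.le) using 1
        abel)
    have hc1 := hBcard L₁ i
    have hc2 := hBcard L₂ i
    rcases le_or_gt L₁.length (i * s) with hi1 | hi1
    · rw [hBempty _ _ hi1, ← bot_eq_empty, bot_symmDiff] at hlong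
      omega
    rcases le_or_gt L₂.length (i * s) with hi2 | hi2
    · rw [hBempty _ _ hi2, ← bot_eq_empty, symmDiff_bot] at hlong
      omega
    rcases Nat.eq_zero_or_pos s with hs0 | hs0
    · have h1 : B L₁ i = ∅ := card_eq_zero.1 (by omega)
      have h2 : B L₂ i = ∅ := card_eq_zero.1 (by omega)
      exact hne (h1.trans h2.symm)
    have hm1 := hBhead L₁ i hi1 hs0
    have hm2 := hBhead L₂ i hi2 hs0
    rw [← hsample i hi] at hm2
    generalize (L₁.getD (i * s) d₁).edge = a at hm1 hm2
    have hsub' : B L₁ i ∆ B L₂ i ⊆ (B L₁ i).erase a ∪ (B L₂ i).erase a := by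
      intro e he
      simp only [mem_union, mem_erase]
      rcases mem_symmDiff.1 he with h | h
      · exact Or.inl ⟨fun h' => h.2 (h' ▸ hm2), h.1⟩
      · exact Or.inr ⟨fun h' => h.2 (h' ▸ hm1), h.1⟩
    have := (card_le_card hsub').trans (card_union_le _ _)
    rw [card_erase_of_mem hm1, card_erase_of_mem hm2] at this
    omega
  have htake (i : ℕ) (hi : i ≤ N) :
      ((L₁.take (i * s)).map SimpleGraph.Dart.edge).toFinset =
        ((L₂.take (i * s)).map SimpleGraph.Dart.edge).toFinset := by
    induction i with
    | zero => simp
    | succ i ih =>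
      simp only [Nat.succ_mul, List.take_add, List.map_append, List.toFinset_append]
      rw [ih (by omega)]
      exact congrArg _ (hB i hi)
  have := htake N le_rfl
  rwa [List.take_of_length_le (by omega), List.take_of_length_le (by omega), h₁.toFinset_eq,
    h₂.toFinset_eq] at this

/-- If `C` is short, then two cycles with the same edges off `C` that agree on one edge of `C`
are equal. -/
lemma IsCycleSet.eq_of_sdiff_eq [Fintype V] {ℓ : ℕ}
    (hgirth : ∀ C : Finset (Sym2 V), IsCycleSet G C → ℓ ≤ C.card)
    {C C₁ C₂ : Finset (Sym2 V)} (hC : IsCycleSet G C) (h₁ : IsCycleSet G C₁)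
    (h₂ : IsCycleSet G C₂) (hlen : C.card < 2 * ℓ) (hsdiff : C₁ \ C = C₂ \ C)
    {e : Sym2 V} (he : e ∈ C) (hiff : e ∈ C₁ ↔ e ∈ C₂) : C₁ = C₂ := by
  by_contra hne
  have hsub : C₁ ∆ C₂ ⊆ C := by
    intro x hx
    by_contra hxC
    have := Finset.ext_iff.1 hsdiff x
    simp only [mem_sdiff, hxC, not_false_eq_true, and_true] at this
    rw [mem_symmDiff] at hx
    tauto
  have heven : ∑ x ∈ C₁ ∆ C₂, edgeBoundary x = 0 := by
    rw [sum_symmDiff_of_zmod_two, h₁.sum_edgeBoundary, h₂.sum_edgeBoundary, add_zero]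
  have heven' : ∑ x ∈ C \ (C₁ ∆ C₂), edgeBoundary x = 0 := by
    have := sum_sdiff (f := edgeBoundary) hsub
    rwa [heven, hC.sum_edgeBoundary, add_zero] at this
  obtain ⟨D, hD, hDc⟩ := exists_isCycleSet_subset_of_even
    (fun x hx => hC.mem_edgeSet x (hsub hx))
    (nonempty_iff_ne_empty.2 fun h => hne (symmDiff_eq_bot.1 h)) heven
  obtain ⟨D', hD', hDc'⟩ := exists_isCycleSet_subset_of_even
    (fun x hx => hC.mem_edgeSet x (sdiff_subset hx))
    ⟨e, mem_sdiff.2 ⟨he, fun h => by rw [mem_symmDiff] at h; tauto⟩⟩ heven'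
  have h1 := (hgirth D hDc).trans (card_le_card hD)
  have h2 := (hgirth D' hDc').trans (card_le_card hD')
  have h3 := card_sdiff_add_card_eq_card hsub
  omega

end CycleOverlap

/-- Cycle overlap counting bound: if `G` has at most `m` edges and no cycle of length strictly
less than `ℓ`, and `C` is a cycle of `G` of length at most `1.01·ℓ`, then for every positive
integer `α` the number of cycles `C' ≠ C` with `|C' \ C| ≤ α·ℓ/4` is at most `(2m)^(2α)`. -/
theorem cycle_overlap_counting_bound {V : Type*} [Fintype V] [DecidableEq V]
    (G : SimpleGraph V) [DecidableRel G.Adj] (m ℓ : ℕ) (hm : 0 < m) (hℓ : 0 < ℓ)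
    (hedges : G.edgeFinset.card ≤ m)
    (hgirth : ∀ C : Finset (Sym2 V), IsCycleSet G C → ℓ ≤ C.card)
    (C : Finset (Sym2 V)) (hC : IsCycleSet G C) (hlen : (C.card : ℝ) ≤ 1.01 * ℓ)
    (α : ℕ) (hα : 0 < α) :
    {C' : Finset (Sym2 V) | IsCycleSet G C' ∧ C' ≠ C ∧
        (((C' \ C).card : ℝ) ≤ (α : ℝ) * ℓ / 4)}.ncard ≤ (2 * m) ^ (2 * α) := by
  classical
  have hlen' : 100 * C.card ≤ 101 * ℓ := by
    have : (100 * C.card : ℝ) ≤ 101 * ℓ := by linarith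
    exact_mod_cast this
  have hC3 := hC.three_le_card
  obtain ⟨e₀, he₀⟩ : C.Nonempty := card_pos.1 (by omega)
  set s := (99 * ℓ + 399) / 400 with hs
  have hs2 : 2 * s + C.card < 2 * ℓ := by
    rcases le_or_gt ℓ 4 with h | h
    · interval_cases ℓ <;> omega
    · omega
  have hcard {C' : Finset (Sym2 V)} (h : ((C' \ C).card : ℝ) ≤ (α : ℝ) * ℓ / 4) :
      4 * (C' \ C).card ≤ α * ℓ := by
    have : (4 * (C' \ C).card : ℝ) ≤ α * ℓ := by linarith
    exact_mod_cast this
  have hne {C' : Finset (Sym2 V)} (h : IsCycleSet G C') (hCC : C' ≠ C) :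
      (C' \ C).Nonempty := by
    rw [nonempty_iff_ne_empty]
    intro h0
    apply hCC
    by_cases he : e₀ ∈ C'
    · exact hC.eq_of_sdiff_eq hgirth h hC (by omega) (by rw [h0, sdiff_self]; rfl) he₀ (by tauto)
    · obtain ⟨x, hx⟩ : C'.Nonempty := card_pos.1 (by have := h.three_le_card; omega)
      have hsub := sdiff_eq_empty_iff_subset.1 h0
      exact hC.eq_of_sdiff_eq hgirth h hC (by omega) (by rw [h0, sdiff_self]; rfl) (hsub hx)
        (by simp [hx, hsub hx])
  have hmemB {C' : Finset (Sym2 V)} (h : IsCycleSet G C') :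
      ∑ e ∈ C' \ C, edgeBoundary e ∈ boundaries C := by
    refine mem_boundaries.2 ⟨C' ∩ C, inter_subset_right, ?_⟩
    have := sum_inter_add_sum_sdiff C' C edgeBoundary
    rw [h.sum_edgeBoundary] at this
    rw [eq_neg_of_add_eq_zero_left this, neg_eq_self_of_zmod_two]
  have hα2 {C' : Finset (Sym2 V)} (h : IsCycleSet G C') (hCC : C' ≠ C)
      (hc : 4 * (C' \ C).card ≤ α * ℓ) : 2 ≤ α := by
    have := two_mul_le_of_sum_mem_boundaries hgirth hC
      (fun e he => h.mem_edgeSet e (sdiff_subset he)) sdiff_disjoint (hne h hCC) (hmemB h)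
    by_contra hα'
    obtain rfl : α = 1 := by omega
    omega
  have hcs {n : ℕ} (hα' : 2 ≤ α) (hc : 4 * n ≤ α * ℓ) : n ≤ (2 * α - 1) * s := by
    have h1 : 99 * ℓ ≤ 400 * s := by omega
    obtain ⟨b, rfl⟩ := Nat.exists_eq_add_of_le hα'
    have h2 : 2 * (2 + b) - 1 = 3 + 2 * b := by omega
    rw [h2]
    nlinarith [Nat.zero_le (b * ℓ), Nat.mul_le_mul_left (3 + 2 * b) h1]
  have hcode (C' : {C' : Finset (Sym2 V) | IsCycleSet G C' ∧ C' ≠ C ∧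
      (((C' \ C).card : ℝ) ≤ (α : ℝ) * ℓ / 4)}) :
      ∃ p : G.Dart × List G.Dart, IsOffTrace C (C'.1 \ C) p.1 p.2 := by
    obtain ⟨d, L, h⟩ := C'.2.1.exists_isOffTrace (hne C'.2.1 C'.2.2.1)
    exact ⟨(d, L), h⟩
  choose p hp using hcode
  let f (C' : {C' : Finset (Sym2 V) | IsCycleSet G C' ∧ C' ≠ C ∧
      (((C' \ C).card : ℝ) ≤ (α : ℝ) * ℓ / 4)}) : (Fin (2 * α - 1) → G.Dart) × Bool :=
    (fun i => (p C').2.getD (i * s) (p C').1, decide (e₀ ∈ C'.1))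
  have hf : Function.Injective f := by
    intro A B hAB
    have hα' := hα2 A.2.1 A.2.2.1 (hcard A.2.2.2)
    simp only [f, Prod.mk.injEq, decide_eq_decide] at hAB
    have hE := (hp A).eq_of_sample_eq hgirth hC (s := s) (N := 2 * α - 1) (by omega) hs2
      (by omega) (hp B) sdiff_disjoint sdiff_disjoint
      (hcs hα' (hcard A.2.2.2)) (hcs hα' (hcard B.2.2.2))
      fun i hi => congrFun hAB.1 ⟨i, hi⟩
    exact Subtype.ext (hC.eq_of_sdiff_eq hgirth A.2.1 B.2.1 (by omega) hE he₀ hAB.2)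
  rw [← Nat.card_coe_set_eq]
  refine (Nat.card_le_card_of_injective f hf).trans ?_
  rw [Nat.card_eq_fintype_card, Fintype.card_prod, Fintype.card_fun, Fintype.card_fin,
    Fintype.card_bool, G.dart_card_eq_twice_card_edges]
  calc (2 * G.edgeFinset.card) ^ (2 * α - 1) * 2 ≤ (2 * m) ^ (2 * α - 1) * (2 * m) := by
        gcongr
        omega
    _ = (2 * m) ^ (2 * α) := by
        rw [← pow_succ]
        congr 1
        omega
end

section
/- Let G be a simple graph whose edge set E has exactly m edges, with m ≥ 2, and containing no cycle of length ≤ ℓ. Let p ∈ [0,1] satisfy p^ℓ = 1/m^{100}, and let C be a cycle of G of length k with ℓ < k ≤ 1.01·ℓ. Form a random subset E' ⊆ E by keeping each edge independently with probability p. Then the probability that both C survives and some cycle C' ≠ C of G survives is at most (4/m^{23}) times the probability that C survives. -/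
/-- The probability, under the product Bernoulli(p) measure on subsets of the finite set `E`
(each element kept independently with probability `p`), of the event `A`. -/
noncomputable def bernoulliSubsetProb {α : Type*} [DecidableEq α] (E : Finset α) (p : ℝ)
    (A : Set (Finset α)) : ℝ :=
  ∑ S ∈ E.powerset,
    Set.indicator A (fun S => p ^ S.card * (1 - p) ^ (E.card - S.card)) S

namespace SimpleGraph.Walk

variable {V : Type*} {G : SimpleGraph V}

lemma IsPath.isAcyclic_fromEdgeSet {u v : V} {p : G.Walk u v} (hp : p.IsPath) :
    (fromEdgeSet {e | e ∈ p.edges}).IsAcyclic := by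
  induction p with
  | nil => simp
  | @cons u v w h p ih =>
    rw [cons_isPath_iff] at hp
    have hsup : fromEdgeSet {e | e ∈ (cons h p).edges} =
        fromEdgeSet {e | e ∈ p.edges} ⊔ edge u v := by
      rw [edge, ← fromEdgeSet_union]
      congr 1
      ext e
      simp
    rw [hsup]
    refine (ih hp.1).sup_edge_of_not_reachable ?_
    rintro ⟨r⟩
    cases r with
    | nil => exact h.ne rfl
    | cons h' r => exact hp.2 (p.fst_mem_support_of_mem_edges ((fromEdgeSet_adj _).1 h').1)

/-- Removing an edge from a cycle leaves a path. -/
lemma IsCycle.exists_isPath_of_mem_edges [DecidableEq V] {u : V} {c : G.Walk u u} (hc : c.IsCycle)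
    {f : Sym2 V} (hf : f ∈ c.edges) :
    ∃ (a b : V) (p : G.Walk a b), p.IsPath ∧ ∀ e ∈ c.edges, e ≠ f → e ∈ p.edges := by
  induction f with
  | h x y =>
    have hx := c.fst_mem_support_of_mem_edges hf
    have hmem : ∀ e, e ∈ (c.rotate x hx).edges ↔ e ∈ c.edges := fun e =>
      (c.rotate_edges x hx).mem_iff
    have hc' := hc.rotate hx
    simp only [← hmem] at hf ⊢
    generalize c.rotate x hx = c' at hf hc'
    cases c' with
    | nil => simp at hf
    | @cons _ v _ h q =>
      rw [cons_isCycle_iff] at hc'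
      by_cases hy : s(x, y) = s(x, v)
      · refine ⟨_, _, q, hc'.1, fun e he hne => ?_⟩
        rw [edges_cons, List.mem_cons] at he
        exact he.resolve_left (hy ▸ hne)
      · have hq : s(x, y) ∈ q.reverse.edges := by simpa [hy] using hf
        have hqe : ∀ e, e ∈ q.edges ↔ e ∈ q.reverse.edges := by simp
        have hqp := hc'.1.reverse
        simp only [edges_cons, List.mem_cons, hqe]
        generalize q.reverse = q' at hq hqp
        cases q' with
        | nil => simp at hq
        | @cons _ z _ h' r =>
          rw [cons_isPath_iff] at hqp
          have hyz : s(x, y) = s(x, z) := by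
            rw [edges_cons, List.mem_cons] at hq
            exact hq.resolve_right fun hr => hqp.2 (r.fst_mem_support_of_mem_edges hr)
          refine ⟨_, _, cons h r.reverse, ?_, fun e he hne => ?_⟩
          · rw [cons_isPath_iff]
            exact ⟨hqp.1.reverse, by simpa using hqp.2⟩
          · rw [hyz] at hne
            simpa [hne] using he

/-- Two vertices of a closed walk are joined by a path along it of at most half its length. -/
lemma exists_isPath_length_le_of_mem_support [DecidableEq V] {u : V} {c : G.Walk u u}
    {a b : V} (ha : a ∈ c.support) (hb : b ∈ c.support) :
    ∃ q : G.Walk a b, q.IsPath ∧ q.edges ⊆ c.edges ∧ 2 * q.length ≤ c.length := by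
  have hb' : b ∈ (c.rotate a ha).support := by simpa using hb
  have hsub : (c.rotate a ha).edges ⊆ c.edges := fun e he => (c.rotate_edges a ha).mem_iff.1 he
  have hlen := congrArg length ((c.rotate a ha).take_spec hb')
  rw [length_append, length_rotate] at hlen
  obtain h | h : 2 * ((c.rotate a ha).takeUntil b hb').length ≤ c.length ∨
      2 * ((c.rotate a ha).dropUntil b hb').reverse.length ≤ c.length := by
    rw [length_reverse]; omega
  · refine ⟨((c.rotate a ha).takeUntil b hb').bypass, bypass_isPath _, fun e he => hsub ?_,
      le_trans ?_ h⟩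
    · exact edges_takeUntil_subset_edges _ hb' (edges_bypass_subset_edges _ he)
    gcongr
    exact length_bypass_le_length _
  · refine ⟨((c.rotate a ha).dropUntil b hb').reverse.bypass, bypass_isPath _,
      fun e he => hsub ?_, le_trans ?_ h⟩
    · replace he := edges_bypass_subset_edges _ he
      rw [edges_reverse, List.mem_reverse] at he
      exact edges_dropUntil_subset_edges _ hb' he
    · gcongr
      exact length_bypass_le_length _

end SimpleGraph.Walk

namespace SimpleGraph

variable {V : Type*}

/-- If `v` is reachable from `u` in the graph with edge set `A` without using `e`, but no longer so
once the edges in `B` are removed, then some end of an edge in `B` is still reachable from `u`. -/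
lemma exists_reachable_of_not_reachable_sdiff {A B : Set (Sym2 V)} {e : Sym2 V}
    {u v : V} (hr : ((fromEdgeSet A).deleteEdges {e}).Reachable u v)
    (hn : ¬ ((fromEdgeSet (A \ B)).deleteEdges {e}).Reachable u v) :
    ∃ a b, s(a, b) ∈ B ∧ ((fromEdgeSet (A \ B)).deleteEdges {e}).Reachable u a := by
  by_contra! hcon
  refine hn ?_
  rw [reachable_iff_reflTransGen] at hr
  induction hr with
  | refl => rfl
  | @tail y z _ hyz ih =>
    have hy : ((fromEdgeSet (A \ B)).deleteEdges {e}).Reachable u y := by_contra fun h => h (ih h)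
    refine hy.trans (Adj.reachable ?_)
    rw [deleteEdges_adj, fromEdgeSet_adj] at hyz ⊢
    exact ⟨⟨⟨hyz.1.1, fun h => hcon y z h hy⟩, hyz.1.2⟩, hyz.2⟩

end SimpleGraph

section CycleSets

open SimpleGraph Walk

variable {V : Type*} [DecidableEq V] {G : SimpleGraph V} {C C' : Finset (Sym2 V)}

lemma SimpleGraph.Walk.IsTrail.card_edges_toFinset {u v : V} {w : G.Walk u v} (hw : w.IsTrail) :
    w.edges.toFinset.card = w.length := by
  rw [List.toFinset_card_of_nodup hw.edges_nodup, length_edges]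

lemma IsCycleSet.coe_subset_edgeSet (hC : IsCycleSet G C) : (C : Set (Sym2 V)) ⊆ G.edgeSet := by
  obtain ⟨u, w, -, rfl⟩ := hC
  intro e he
  exact w.edges_subset_edgeSet (by simpa using he)

lemma IsCycleSet.mono {H : SimpleGraph V} (h : G ≤ H) (hC : IsCycleSet G C) : IsCycleSet H C := by
  obtain ⟨u, w, hw, rfl⟩ := hC
  exact ⟨u, w.mapLe h, hw.mapLe h, by simp⟩

lemma SimpleGraph.exists_isCycleSet_of_not_isAcyclic (h : ¬ G.IsAcyclic) :
    ∃ C, IsCycleSet G C := by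
  simp only [IsAcyclic, not_forall, not_not] at h
  obtain ⟨u, w, hw⟩ := h
  exact ⟨_, u, w, hw, rfl⟩

lemma IsCycleSet.not_isAcyclic_fromEdgeSet (hC : IsCycleSet G C) {A : Set (Sym2 V)}
    (hA : (C : Set (Sym2 V)) ⊆ A) : ¬ (fromEdgeSet A).IsAcyclic := by
  obtain ⟨u, w, hw, rfl⟩ := hC
  have hmem : ∀ e ∈ w.edges, e ∈ (fromEdgeSet A).edgeSet := fun e he => by
    rw [edgeSet_fromEdgeSet]
    exact ⟨hA (by simpa using he), not_isDiag_of_mem_edgeSet G (w.edges_subset_edgeSet he)⟩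
  exact fun h => h _ (hw.transfer hmem)

lemma IsCycleSet.eq_of_subset (hC : IsCycleSet G C) (hC' : IsCycleSet G C') (h : C' ⊆ C) :
    C' = C := by
  by_contra hne
  obtain ⟨f, hf, hf'⟩ := Finset.exists_of_ssubset (h.ssubset_of_ne hne)
  obtain ⟨u, w, hw, rfl⟩ := hC
  obtain ⟨a, b, p, hp, hpe⟩ := hw.exists_isPath_of_mem_edges (by simpa using hf)
  refine hC'.not_isAcyclic_fromEdgeSet (fun e he => ?_) hp.isAcyclic_fromEdgeSet
  exact hpe e (by simpa using h he) fun hef => hf' (hef ▸ he)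

/-- Two distinct paths with the same endpoints contain a cycle. -/
lemma SimpleGraph.Walk.IsPath.exists_isCycleSet {a b : V} {p q : G.Walk a b} (hp : p.IsPath)
    (hq : q.IsPath) (hpq : p ≠ q) :
    ∃ C, IsCycleSet G C ∧ C.card ≤ p.length + q.length := by
  set A : Finset (Sym2 V) := p.edges.toFinset ∪ q.edges.toFinset with hA
  have hAG : fromEdgeSet (A : Set (Sym2 V)) ≤ G := by
    rw [fromEdgeSet_le]
    rintro e ⟨he, -⟩
    obtain he | he : e ∈ p.edges ∨ e ∈ q.edges := by simpa [hA] using he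
    exacts [p.edges_subset_edgeSet he, q.edges_subset_edgeSet he]
  have hpA : ∀ e ∈ p.edges, e ∈ (fromEdgeSet (A : Set (Sym2 V))).edgeSet := fun e he => by
    rw [edgeSet_fromEdgeSet]
    exact ⟨by simp [hA, he], not_isDiag_of_mem_edgeSet G (p.edges_subset_edgeSet he)⟩
  have hqA : ∀ e ∈ q.edges, e ∈ (fromEdgeSet (A : Set (Sym2 V))).edgeSet := fun e he => by
    rw [edgeSet_fromEdgeSet]
    exact ⟨by simp [hA, he], not_isDiag_of_mem_edgeSet G (q.edges_subset_edgeSet he)⟩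
  have hcyc : ¬ (fromEdgeSet (A : Set (Sym2 V))).IsAcyclic := fun hac => by
    have h := congrArg (fun r : (fromEdgeSet (A : Set (Sym2 V))).Path a b => r.1.support)
      ((hac.subsingleton_path a b).elim ⟨_, hp.transfer hpA⟩ ⟨_, hq.transfer hqA⟩)
    simp only [support_transfer] at h
    exact hpq (ext_support h)
  obtain ⟨C, hC⟩ := exists_isCycleSet_of_not_isAcyclic hcyc
  refine ⟨C, hC.mono hAG, ?_⟩
  have hCA : C ⊆ A := fun e he => by
    have := hC.coe_subset_edgeSet he
    rw [edgeSet_fromEdgeSet] at this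
    exact this.1
  calc C.card ≤ A.card := Finset.card_le_card hCA
    _ ≤ p.edges.toFinset.card + q.edges.toFinset.card := Finset.card_union_le _ _
    _ = p.length + q.length := by
      rw [hp.isTrail.card_edges_toFinset, hq.isTrail.card_edges_toFinset]

/-- If a cycle `C'` differs from `C`, then the edges of `C'` outside `C` contain a path of any
prescribed length `s` that is not too large compared with the girth. -/
lemma IsCycleSet.exists_isPath_disjoint {ℓ s : ℕ}
    (hgirth : ∀ D, IsCycleSet G D → ℓ < D.card) (hC : IsCycleSet G C) (hC' : IsCycleSet G C')
    (hne : C' ≠ C) (hsℓ : s ≤ ℓ) (hs : C.card + 2 * s ≤ 2 * ℓ + 2) :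
    ∃ (a b : V) (p : G.Walk a b), p.IsPath ∧ p.length = s ∧
      Disjoint p.edges.toFinset C ∧ p.edges.toFinset ⊆ C' := by
  obtain ⟨c, w, hw, rfl⟩ := hC
  set H := fromEdgeSet ((C' : Set (Sym2 V)) \ {e | e ∈ w.edges}) with hH
  have hHe : ∀ e, e ∈ H.edgeSet → e ∈ C' ∧ e ∉ w.edges := fun e he => by
    rw [hH, edgeSet_fromEdgeSet] at he
    exact he.1
  have hHG : H ≤ G := by
    rw [hH, fromEdgeSet_le]
    exact fun e he => hC'.coe_subset_edgeSet he.1.1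
  suffices h : ∃ (a b : V) (p : H.Walk a b), p.IsPath ∧ s ≤ p.length by
    obtain ⟨a, b, p, hp, hps⟩ := h
    refine ⟨_, _, (p.take s).mapLe hHG, (hp.take s).mapLe hHG, by simpa using hps, ?_, ?_⟩
    · rw [Finset.disjoint_left]
      intro e he
      rw [edges_mapLe_eq_edges, List.mem_toFinset] at he
      simpa using (hHe e (edges_subset_edgeSet _ he)).2
    · intro e he
      rw [edges_mapLe_eq_edges, List.mem_toFinset] at he
      exact (hHe e (edges_subset_edgeSet _ he)).1
  by_cases hac : H.IsAcyclic
  swap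
  · simp only [IsAcyclic, not_forall, not_not] at hac
    obtain ⟨u, r, hr⟩ := hac
    have hlen : ℓ < r.length := by
      have := hgirth _ (IsCycleSet.mono hHG ⟨u, r, hr, rfl⟩)
      rwa [hr.isTrail.card_edges_toFinset] at this
    refine ⟨_, _, r.take s, hr.isPath_take (hsℓ.trans_lt hlen), ?_⟩
    rw [take_length]
    omega
  have hns : ¬ C' ⊆ w.edges.toFinset := fun h =>
    hne (IsCycleSet.eq_of_subset ⟨c, w, hw, rfl⟩ hC' h)
  obtain ⟨e, heC', hew⟩ := Finset.not_subset.1 hns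
  induction e with
  | h u v =>
  have hadj : H.Adj u v := by
    rw [hH, fromEdgeSet_adj]
    exact ⟨⟨heC', by simpa using hew⟩, G.ne_of_adj (hC'.coe_subset_edgeSet heC')⟩
  have hbr : ¬ (H.deleteEdges {s(u, v)}).Reachable u v :=
    isBridge_iff.1 (isAcyclic_iff_forall_isBridge.1 hac hadj)
  have hcyc : ((fromEdgeSet (C' : Set (Sym2 V))).deleteEdges {s(u, v)}).Reachable u v := by
    refine (adj_and_reachable_delete_edges_iff_exists_cycle.2 ?_).2
    obtain ⟨x, r, hr, rfl⟩ := hC'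
    have hmem : ∀ e ∈ r.edges,
        e ∈ (fromEdgeSet (r.edges.toFinset : Set (Sym2 V))).edgeSet := fun e he => by
      rw [edgeSet_fromEdgeSet]
      exact ⟨by simpa using he, not_isDiag_of_mem_edgeSet G (r.edges_subset_edgeSet he)⟩
    exact ⟨x, _, hr.transfer hmem, by simpa using heC'⟩
  obtain ⟨a, _, ha, hua⟩ := exists_reachable_of_not_reachable_sdiff hcyc hbr
  obtain ⟨b, _, hb, hvb⟩ :=
    exists_reachable_of_not_reachable_sdiff hcyc.symm fun h => hbr h.symm
  have hab : a ≠ b := by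
    rintro rfl
    exact hbr (hua.trans hvb.symm)
  have hle := deleteEdges_le (G := H) {s(u, v)}
  obtain ⟨p, hp⟩ := ((hua.mono hle).symm.trans
    (hadj.reachable.trans (hvb.mono hle))).exists_isPath
  obtain ⟨q, hq, hqw, hql⟩ := exists_isPath_length_le_of_mem_support
    (w.fst_mem_support_of_mem_edges ha) (w.fst_mem_support_of_mem_edges hb)
  refine ⟨a, b, p, hp, ?_⟩
  have hpq : p.mapLe hHG ≠ q := by
    rintro rfl
    cases p with
    | nil => exact hab rfl
    | @cons _ z _ h p => exact (hHe s(a, z) h).2 (hqw (by simp))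
  obtain ⟨D, hD, hDc⟩ := (hp.mapLe hHG).exists_isCycleSet hq hpq
  have := hgirth D hD
  rw [hw.isTrail.card_edges_toFinset] at hs
  rw [length_mapLe] at hDc
  omega

lemma SimpleGraph.Walk.mem_image_fst_darts [Fintype V] [DecidableRel G.Adj] {a b : V}
    (p : G.Walk a b) (hp : 0 < p.length) :
    a ∈ (Finset.univ : Finset G.Dart).image fun d => d.fst := by
  cases p with
  | nil => simp at hp
  | cons h p => exact Finset.mem_image.2 ⟨⟨(_, _), h⟩, Finset.mem_univ _, rfl⟩

/-- If `2 * s` is at most the girth bound, then paths of length `s` are determined by their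
endpoints, so there are at most `(2 * m) ^ 2` of them. -/
lemma SimpleGraph.exists_finset_edges_isPath [Fintype V] [DecidableRel G.Adj] {ℓ s : ℕ}
    (hgirth : ∀ D, IsCycleSet G D → ℓ < D.card) (hs0 : 0 < s) (hsℓ : 2 * s ≤ ℓ) :
    ∃ F : Finset (Finset (Sym2 V)), F.card ≤ (2 * G.edgeFinset.card) ^ 2 ∧
      ∀ P, P ∈ F ↔ ∃ (a b : V) (p : G.Walk a b),
        p.IsPath ∧ p.length = s ∧ p.edges.toFinset = P := by
  classical
  set W := (Finset.univ : Finset G.Dart).image fun d => d.fst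
  have hW : W.card ≤ 2 * G.edgeFinset.card := by
    rw [← G.dart_card_eq_twice_card_edges]
    exact Finset.card_image_le
  refine ⟨Finset.univ.filter fun P => ∃ (a b : V) (p : G.Walk a b),
        p.IsPath ∧ p.length = s ∧ p.edges.toFinset = P, ?_, by simp⟩
  set F := Finset.univ.filter fun P => ∃ (a b : V) (p : G.Walk a b),
        p.IsPath ∧ p.length = s ∧ p.edges.toFinset = P with hF
  have hends : ∀ P : F, ∃ x : V × V, ∃ p : G.Walk x.1 x.2,
      p.IsPath ∧ p.length = s ∧ p.edges.toFinset = P := fun P => by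
    obtain ⟨a, b, p, hp⟩ := (Finset.mem_filter.1 P.2).2
    exact ⟨(a, b), p, hp⟩
  choose x p hp hps hpP using hends
  have hxW : ∀ P, x P ∈ W ×ˢ W := fun P => Finset.mem_product.2
    ⟨(p P).mem_image_fst_darts (by rw [hps]; exact hs0),
      (p P).reverse.mem_image_fst_darts (by rw [length_reverse, hps]; exact hs0)⟩
  have hinj : ∀ P Q, x P = x Q → P = Q := by
    intro P Q hPQ
    have huniq : ∀ (y : V × V), y = x P → ∀ q : G.Walk y.1 y.2, q.IsPath → q.length = s →
        q.edges = (p P).edges := by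
      rintro y rfl q hq hqs
      by_contra hne
      obtain ⟨D, hD, hDc⟩ := hq.exists_isCycleSet (hp P) fun h => hne (h ▸ rfl)
      have := hgirth D hD
      have := hps P
      omega
    rw [Subtype.ext_iff, ← hpP P, ← hpP Q, huniq _ hPQ.symm (p Q) (hp Q) (hps Q)]
  calc F.card = F.attach.card := Finset.card_attach.symm
    _ ≤ (W ×ˢ W).card := Finset.card_le_card_of_injOn x (fun P _ => hxW P)
        fun P _ Q _ h => hinj P Q h
    _ = W.card ^ 2 := by rw [Finset.card_product, sq]
    _ ≤ _ := by gcongr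

end CycleSets

section Bernoulli

variable {α : Type*} [DecidableEq α] {E : Finset α} {p : ℝ}

lemma bernoulliSubsetProb_superset {T : Finset α} (hT : T ⊆ E) :
    bernoulliSubsetProb E p {S | T ⊆ S} = p ^ T.card := by
  have himage : E.powerset.filter (T ⊆ ·) = (E \ T).powerset.image (T ∪ ·) := by
    ext S
    simp only [Finset.mem_filter, Finset.mem_powerset, Finset.mem_image]
    constructor
    · rintro ⟨hS, hTS⟩
      exact ⟨S \ T, Finset.sdiff_subset_sdiff hS le_rfl, Finset.union_sdiff_of_subset hTS⟩
    · rintro ⟨U, hU, rfl⟩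
      exact ⟨Finset.union_subset hT (hU.trans Finset.sdiff_subset), Finset.subset_union_left⟩
  have hdisj : ∀ U ∈ (E \ T).powerset, Disjoint T U := fun U hU =>
    Finset.disjoint_of_subset_right (Finset.mem_powerset.1 hU) Finset.disjoint_sdiff
  have hinj : Set.InjOn (T ∪ ·) ((E \ T).powerset : Set (Finset α)) := by
    intro U hU U' hU' h
    rw [← Finset.union_sdiff_cancel_left (hdisj U hU),
      ← Finset.union_sdiff_cancel_left (hdisj U' hU')]
    exact congrArg (· \ T) h
  calc bernoulliSubsetProb E p {S | T ⊆ S}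
      = ∑ S ∈ E.powerset.filter (T ⊆ ·), p ^ S.card * (1 - p) ^ (E.card - S.card) := by
        rw [bernoulliSubsetProb, Finset.sum_filter]
        simp only [Set.indicator_apply, Set.mem_ofPred_eq]
    _ = ∑ U ∈ (E \ T).powerset,
          p ^ T.card * (p ^ U.card * (1 - p) ^ ((E \ T).card - U.card)) := by
        rw [himage, Finset.sum_image hinj]
        refine Finset.sum_congr rfl fun U hU => ?_
        rw [Finset.card_union_of_disjoint (hdisj U hU), Finset.card_sdiff_of_subset hT,
          Nat.sub_sub, pow_add, mul_assoc]
    _ = p ^ T.card := by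
        rw [← Finset.mul_sum, Finset.sum_pow_mul_eq_add_pow]
        simp

/-- The union bound. -/
lemma bernoulliSubsetProb_le_sum (hp0 : 0 ≤ p) (hp1 : p ≤ 1) {ι : Type*} (I : Finset ι)
    {A : Set (Finset α)} (B : ι → Set (Finset α))
    (hA : ∀ S ∈ A, S ⊆ E → ∃ i ∈ I, S ∈ B i) :
    bernoulliSubsetProb E p A ≤ ∑ i ∈ I, bernoulliSubsetProb E p (B i) := by
  unfold bernoulliSubsetProb
  rw [Finset.sum_comm]
  refine Finset.sum_le_sum fun S hS => ?_
  have hnn : ∀ S : Finset α, 0 ≤ p ^ S.card * (1 - p) ^ (E.card - S.card) := fun S =>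
    mul_nonneg (pow_nonneg hp0 _) (pow_nonneg (sub_nonneg.2 hp1) _)
  have hnn' : ∀ i ∈ I, 0 ≤ Set.indicator (B i)
      (fun S => p ^ S.card * (1 - p) ^ (E.card - S.card)) S := fun i _ =>
    Set.indicator_nonneg (fun S _ => hnn S) S
  by_cases hSA : S ∈ A
  · obtain ⟨i, hi, hSi⟩ := hA S hSA (Finset.mem_powerset.1 hS)
    rw [Set.indicator_of_mem hSA]
    refine le_trans (le_of_eq ?_) (Finset.single_le_sum hnn' hi)
    rw [Set.indicator_of_mem hSi]
  · rw [Set.indicator_of_notMem hSA]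
    exact Finset.sum_nonneg hnn'

end Bernoulli

/-- If `G` has exactly `m ≥ 2` edges and no cycle of length `≤ ℓ`, `p^ℓ = 1/m^100`, and `C` is a
cycle of length `k` with `ℓ < k ≤ 1.01·ℓ`, then under Bernoulli(p) sampling of the edges, the
probability that `C` survives together with some other cycle is at most `4/m^23` times the
probability that `C` survives. -/
theorem other_cycle_survival_prob {V : Type*} [Fintype V] [DecidableEq V]
    (G : SimpleGraph V) [DecidableRel G.Adj] (m ℓ : ℕ) (hm : 2 ≤ m)
    (hedges : G.edgeFinset.card = m)
    (hgirth : ∀ C : Finset (Sym2 V), IsCycleSet G C → ℓ < C.card)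
    (p : ℝ) (hp0 : 0 ≤ p) (hp1 : p ≤ 1) (hpl : p ^ ℓ = 1 / (m : ℝ) ^ 100)
    (C : Finset (Sym2 V)) (hC : IsCycleSet G C)
    (hk1 : ℓ < C.card) (hk2 : (C.card : ℝ) ≤ 1.01 * ℓ) :
    bernoulliSubsetProb G.edgeFinset p
        {E' | C ⊆ E' ∧ ∃ C' : Finset (Sym2 V), IsCycleSet G C' ∧ C' ≠ C ∧ C' ⊆ E'} ≤
      (4 / (m : ℝ) ^ 23) * bernoulliSubsetProb G.edgeFinset p {E' | C ⊆ E'} := by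
  have hm1 : (1 : ℝ) < m := by exact_mod_cast hm
  have hm0 : (0 : ℝ) < m := by linarith
  have hℓ : 100 ≤ ℓ := by
    have h : (ℓ : ℝ) + 1 ≤ C.card := by exact_mod_cast hk1
    have : (100 : ℝ) ≤ ℓ := by linarith
    exact_mod_cast this
  have hk : 100 * C.card ≤ 101 * ℓ := by
    have : (100 * C.card : ℝ) ≤ 101 * ℓ := by linarith
    exact_mod_cast this
  obtain ⟨s, hs⟩ : ∃ s, s = ℓ / 4 + 1 := ⟨_, rfl⟩
  have hps : p ^ s ≤ 1 / (m : ℝ) ^ 25 := by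
    refine le_of_pow_le_pow_left₀ (n := 4) (by norm_num) (by positivity) ?_
    calc (p ^ s) ^ 4 = p ^ (s * 4) := by rw [pow_mul]
      _ ≤ p ^ ℓ := pow_le_pow_of_le_one hp0 hp1 (by omega)
      _ = (1 / (m : ℝ) ^ 25) ^ 4 := by rw [hpl, div_pow, ← pow_mul, one_pow]
  obtain ⟨F, hFcard, hF⟩ := SimpleGraph.exists_finset_edges_isPath hgirth
    (s := s) (by omega) (by omega)
  rw [hedges] at hFcard
  have hCE : C ⊆ G.edgeFinset := fun e he => by simpa using hC.coe_subset_edgeSet he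
  have hterm : ∀ P ∈ F.filter (Disjoint · C),
      bernoulliSubsetProb G.edgeFinset p {S | P ∪ C ⊆ S} = p ^ s * p ^ C.card := by
    intro P hP
    obtain ⟨hPF, hPC⟩ := Finset.mem_filter.1 hP
    obtain ⟨a, b, r, hr, hrs, rfl⟩ := (hF P).1 hPF
    have hrE : r.edges.toFinset ⊆ G.edgeFinset := fun e he => by
      simpa using r.edges_subset_edgeSet (by simpa using he)
    rw [bernoulliSubsetProb_superset (Finset.union_subset hrE hCE),
      Finset.card_union_of_disjoint hPC, hr.isTrail.card_edges_toFinset, hrs, pow_add]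
  rw [bernoulliSubsetProb_superset hCE]
  calc _ ≤ ∑ P ∈ F.filter (Disjoint · C),
        bernoulliSubsetProb G.edgeFinset p {S | P ∪ C ⊆ S} := by
        refine bernoulliSubsetProb_le_sum hp0 hp1 _ _ ?_
        rintro S ⟨hCS, C', hC', hne, hC'S⟩ -
        obtain ⟨a, b, r, hr, hrs, hrC, hrC'⟩ :=
          hC.exists_isPath_disjoint (s := s) hgirth hC' hne (by omega) (by omega)
        exact ⟨_, Finset.mem_filter.2 ⟨(hF _).2 ⟨a, b, r, hr, hrs, rfl⟩, hrC⟩,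
          Finset.union_subset (hrC'.trans hC'S) hCS⟩
    _ = (F.filter (Disjoint · C)).card * (p ^ s * p ^ C.card) := by
        rw [Finset.sum_congr rfl hterm, Finset.sum_const, nsmul_eq_mul]
    _ ≤ (2 * m) ^ 2 * (1 / (m : ℝ) ^ 25 * p ^ C.card) := by
        gcongr
        exact_mod_cast (Finset.card_filter_le _ _).trans hFcard
    _ = 4 / (m : ℝ) ^ 23 * p ^ C.card := by
        field_simp
        ring
end

section
/- Let G be a simple graph whose edge set E has exactly m edges, with m ≥ 2, and containing no cycle of length ≤ ℓ. Let p ∈ [0,1] satisfy p^ℓ = 1/m^{100}. Form m^{102} mutually independent random subsets E^{(1)}, …, E^{(m^{102})} of E, each obtained by keeping every edge independently with probability p. Then with probability at least 1 − (2m)^4 · (1 − 1/(2m^{101}))^{m^{102}}, for every cycle C of G of length in (ℓ, 1.01·ℓ] there exists an index i such that C is the unique cycle of G all of whose edges lie in E^{(i)}. -/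
/-- The probability of an event `A` for `N` mutually independent random subsets of the finite
set `E`, each obtained by keeping every element independently with probability `p`. -/
noncomputable def bernoulliTupleProb {α : Type*} [DecidableEq α] (E : Finset α) (p : ℝ)
    (N : ℕ) (A : Set (Fin N → Finset α)) : ℝ :=
  ∑ f ∈ Fintype.piFinset (fun _ : Fin N => E.powerset),
    Set.indicator A
      (fun f => ∏ i : Fin N, p ^ (f i).card * (1 - p) ^ (E.card - (f i).card)) f

namespace SimpleGraph.Walk

variable {V : Type*} {G : SimpleGraph V}

/-- Two vertices of a closed walk are joined by a path inside it of at most half its length. -/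
theorem exists_isPath_two_mul_length_le [DecidableEq V] {u a b : V} (c : G.Walk u u)
    (ha : a ∈ c.support) (hb : b ∈ c.support) :
    ∃ q : G.Walk a b, q.IsPath ∧ q.edges ⊆ c.edges ∧ 2 * q.length ≤ c.length := by
  have hb' : b ∈ (c.rotate a ha).support := (c.mem_support_rotate_iff a ha).2 hb
  have hlen : ((c.rotate a ha).takeUntil b hb').length +
      ((c.rotate a ha).dropUntil b hb').length = c.length := by
    rw [← length_append, take_spec, length_rotate]
  have hsub : (c.rotate a ha).edges ⊆ c.edges := (c.rotate_edges a ha).perm.subset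
  rcases le_total ((c.rotate a ha).takeUntil b hb').length
    ((c.rotate a ha).dropUntil b hb').length with h | h
  · refine ⟨_, bypass_isPath ((c.rotate a ha).takeUntil b hb'), ?_, ?_⟩
    · exact fun e he => hsub (edges_takeUntil_subset_edges _ _ (edges_bypass_subset_edges _ he))
    · have := length_bypass_le_length ((c.rotate a ha).takeUntil b hb')
      omega
  · refine ⟨_, bypass_isPath ((c.rotate a ha).dropUntil b hb').reverse, ?_, ?_⟩
    · intro e he
      have := edges_bypass_subset_edges _ he
      rw [edges_reverse, List.mem_reverse] at this
      exact hsub (edges_dropUntil_subset_edges _ _ this)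
    · have := length_bypass_le_length ((c.rotate a ha).dropUntil b hb').reverse
      rw [length_reverse] at this
      omega

/-- In a graph of large girth, paths of small total length are determined by their endpoints. -/
theorem IsPath.eq_of_length_add_length_le {ℓ : ℕ}
    (hg : ∀ (u : V) (c : G.Walk u u), c.IsCycle → ℓ < c.length) {a b : V} {p q : G.Walk a b}
    (hp : p.IsPath) (hq : q.IsPath) (h : p.length + q.length ≤ ℓ) : p = q := by
  by_contra hne
  obtain ⟨w, -, -, c, hc, hle⟩ := hp.exists_isCycle_length_le_add_of_ne hq hne
  have := hg w c hc
  omega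

/-- In a graph of large girth, a walk between two vertices of a cycle `c` that leaves `c` with its
first edge stays away from `c` for a long time. -/
theorem take_avoids_closedWalk [DecidableEq V] {ℓ t : ℕ}
    (hg : ∀ (u : V) (c : G.Walk u u), c.IsCycle → ℓ < c.length) {u a b : V} (c : G.Walk u u)
    (hct : c.length / 2 + t ≤ ℓ) (w : G.Walk a b) (hw : ∀ k < t, (w.take k).IsPath)
    (ha : a ∈ c.support) (hb : b ∈ c.support) (hnil : ¬ w.Nil) (hfst : s(a, w.snd) ∉ c.edges) :
    t ≤ w.length ∧ ∀ e ∈ (w.take t).edges, e ∉ c.edges := by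
  have hpos : 0 < w.length := not_nil_iff_lt_length.1 hnil
  have hex : ∃ k, 1 ≤ k ∧ w.getVert k ∈ c.support := ⟨w.length, hpos, by simpa using hb⟩
  obtain ⟨h1, hk⟩ := Nat.find_spec hex
  have hmin : ∀ i, 1 ≤ i → i < Nat.find hex → w.getVert i ∉ c.support := fun i hi hlt hmem =>
    Nat.find_min hex hlt ⟨hi, hmem⟩
  have hkl : Nat.find hex ≤ w.length := Nat.find_min' hex ⟨hpos, by simpa using hb⟩
  generalize Nat.find hex = k at h1 hk hmin hkl
  have htk : t ≤ k := by
    by_contra! hlt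
    obtain ⟨q, hq, hqc, hql⟩ := c.exists_isPath_two_mul_length_le ha hk
    have heq : w.take k = q := (hw k hlt).eq_of_length_add_length_le hg hq (by
      rw [take_length]; omega)
    apply hfst
    apply hqc
    rw [← heq, edges_take]
    rw [List.mem_take_iff_getElem]
    refine ⟨0, by simp; omega, ?_⟩
    simp [getElem_edges]
  refine ⟨htk.trans hkl, fun e he hec => ?_⟩
  rw [edges_take, List.mem_take_iff_getElem] at he
  obtain ⟨i, hi, rfl⟩ := he
  rw [getElem_edges] at hec
  rcases Nat.eq_zero_or_pos i with rfl | hi0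
  · apply hfst
    simpa using hec
  · refine hmin i hi0 ?_ (c.fst_mem_support_of_mem_edges hec)
    simp at hi
    omega

/-- In a graph of large girth, a cycle `w` not contained in a cycle `c` has a long subpath that is
edge-disjoint from `c`. -/
theorem IsCycle.exists_isPath_avoiding [DecidableEq V] {ℓ t : ℕ}
    (hg : ∀ (u : V) (c : G.Walk u u), c.IsCycle → ℓ < c.length) {u v : V} (c : G.Walk u u)
    (hct : c.length / 2 + t ≤ ℓ) {w : G.Walk v v} (hw : w.IsCycle) (hwc : ¬ w.edges ⊆ c.edges) :
    ∃ (a b : V) (q : G.Walk a b), q.IsPath ∧ q.length = t ∧ q.edges ⊆ w.edges ∧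
      ∀ e ∈ q.edges, e ∉ c.edges := by
  by_cases hmeet : ∃ x ∈ w.support, x ∈ c.support
  · obtain ⟨x, hxw, hxc⟩ := hmeet
    have hr : (w.rotate x hxw).IsCycle := hw.rotate hxw
    have hperm := (w.rotate_edges x hxw).perm
    generalize w.rotate x hxw = r at hr hperm
    have hrl := hg _ r hr
    have hex : ∃ j, ∃ h : j < r.edges.length, r.edges[j] ∉ c.edges := by
      by_contra! hall
      refine hwc fun e he => ?_
      obtain ⟨j, hj, rfl⟩ := List.getElem_of_mem (hperm.mem_iff.2 he)
      exact hall j hj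
    obtain ⟨hjl, hj⟩ := Nat.find_spec hex
    have hmin : ∀ i (h : i < r.edges.length), i < Nat.find hex → r.edges[i] ∈ c.edges :=
      fun i h hlt => by
        by_contra hi
        exact Nat.find_min hex hlt ⟨h, hi⟩
    generalize Nat.find hex = j at hjl hj hmin
    rw [length_edges] at hjl
    have hstart : r.getVert j ∈ c.support := by
      rcases Nat.eq_zero_or_pos j with rfl | hj0
      · simpa using hxc
      · have := hmin (j - 1) (by simp; omega) (by omega)
        rw [getElem_edges, Nat.sub_add_cancel hj0] at this
        exact c.snd_mem_support_of_mem_edges this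
    obtain ⟨h1, h2⟩ := take_avoids_closedWalk hg c hct (r.drop j) (fun k hk => by
        rcases Nat.eq_zero_or_pos j with rfl | hj0
        · have := hr.isPath_take (n := k) (by omega)
          rw [isPath_def, support_take] at this ⊢
          simpa [drop_zero] using this
        · exact (hr.isPath_drop hj0).take k) hstart hxc (by rw [nil_drop_iff]; omega) (by
        rw [getElem_edges] at hj
        simpa [snd, drop_getVert] using hj)
    refine ⟨_, _, (r.drop j).take t, ?_, ?_, ?_, h2⟩
    · rcases Nat.eq_zero_or_pos j with rfl | hj0
      · have := hr.isPath_take (n := t) (by omega)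
        rw [isPath_def, support_take] at this ⊢
        simpa [drop_zero] using this
      · exact (hr.isPath_drop hj0).take t
    · rw [take_length]; omega
    · rw [edges_take, edges_drop]
      exact fun e he => hperm.subset (List.drop_subset _ _ (List.take_subset _ _ he))
  · push Not at hmeet
    have hwl := hg _ w hw
    refine ⟨_, _, w.take t, hw.isPath_take (by omega), by rw [take_length]; omega, ?_, ?_⟩
    · rw [edges_take]
      exact List.take_subset _ _
    · intro e he hec
      rw [edges_take] at he
      have hew := List.take_subset _ _ he
      induction e with
      | _ x y => exact hmeet x (w.fst_mem_support_of_mem_edges hew)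
                  (c.fst_mem_support_of_mem_edges hec)

end SimpleGraph.Walk

namespace Finset

variable {α : Type*} [DecidableEq α]

/-- The probability that a Bernoulli subset of `E` contains a given set `T`. -/
theorem sum_bernoulli_superset {E T : Finset α} (hT : T ⊆ E) (p : ℝ) :
    ∑ S ∈ E.powerset with T ⊆ S, p ^ S.card * (1 - p) ^ (E.card - S.card) = p ^ T.card := by
  have h : ∑ S ∈ (E \ T).powerset, p ^ S.card * (1 - p) ^ ((E \ T).card - S.card) = 1 := by
    rw [sum_pow_mul_eq_add_pow]; simp
  refine Eq.trans ?_ ((congrArg (p ^ T.card * ·) h).trans (mul_one _))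
  rw [mul_sum]
  refine sum_nbij' (fun S => S \ T) (fun S => T ∪ S) ?_ ?_ ?_ ?_ ?_
  · intro S hS
    simp only [mem_filter, mem_powerset] at hS ⊢
    exact sdiff_subset_sdiff hS.1 le_rfl
  · intro S hS
    simp only [mem_filter, mem_powerset] at hS ⊢
    exact ⟨union_subset hT (hS.trans sdiff_subset), subset_union_left⟩
  · intro S hS
    simp only [mem_filter, mem_powerset] at hS
    exact union_sdiff_of_subset hS.2
  · intro S hS
    simp only [mem_powerset] at hS
    exact union_sdiff_cancel_left (disjoint_sdiff.mono_right hS)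
  · intro S hS
    simp only [mem_filter, mem_powerset] at hS
    have h1 := card_sdiff_add_card_eq_card hS.2
    have h2 := card_sdiff_add_card_eq_card hT
    have h3 := card_le_card hS.1
    rw [show E.card - S.card = (E \ T).card - (S \ T).card by omega, ← h1, pow_add]
    ring

/-- A lower bound for the probability that a Bernoulli subset contains `C` but none of the members
of a family of `t`-sets disjoint from `C`. -/
theorem le_sum_bernoulli_superset_avoiding {E C : Finset α} (hC : C ⊆ E) {p : ℝ} (hp0 : 0 ≤ p)
    (hp1 : p ≤ 1) {t : ℕ} (F : Finset (Finset α))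
    (hF : ∀ Q ∈ F, Q ⊆ E ∧ Disjoint C Q ∧ Q.card = t) (good : Finset α → Prop) [DecidablePred good]
    (hgood : ∀ S ⊆ E, C ⊆ S → (∀ Q ∈ F, ¬ Q ⊆ S) → good S) :
    p ^ C.card * (1 - F.card * p ^ t) ≤
      ∑ S ∈ E.powerset with good S, p ^ S.card * (1 - p) ^ (E.card - S.card) := by
  set wt : Finset α → ℝ := fun S => p ^ S.card * (1 - p) ^ (E.card - S.card) with hwt
  have hnn : ∀ S, 0 ≤ wt S := fun S => mul_nonneg (pow_nonneg hp0 _) (pow_nonneg (by linarith) _)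
  have hcover : ∑ S ∈ E.powerset with C ⊆ S, wt S ≤
      ∑ S ∈ E.powerset with good S, wt S +
        ∑ Q ∈ F, ∑ S ∈ E.powerset with C ∪ Q ⊆ S, wt S := by
    simp only [sum_filter]
    rw [sum_comm, ← sum_add_distrib]
    refine sum_le_sum fun S hS => ?_
    have hsum : 0 ≤ ∑ Q ∈ F, if C ∪ Q ⊆ S then wt S else 0 :=
      sum_nonneg fun Q _ => by split_ifs <;> simp [hnn]
    have hS' := mem_powerset.1 hS
    by_cases hCS : C ⊆ S
    · by_cases hg : good S
      · simp only [hCS, hg, if_true]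
        linarith
      · obtain ⟨Q, hQ, hQS⟩ : ∃ Q ∈ F, Q ⊆ S := by
          by_contra! hno
          exact hg (hgood S hS' hCS hno)
        have := single_le_sum (f := fun Q => if C ∪ Q ⊆ S then wt S else 0)
          (fun Q _ => by split_ifs <;> simp [hnn]) hQ
        simpa [hCS, hg, union_subset hCS hQS] using this
    · simp only [hCS, if_false]
      split_ifs
      · linarith [hnn S]
      · linarith
  have hQ : ∑ Q ∈ F, ∑ S ∈ E.powerset with C ∪ Q ⊆ S, wt S = F.card * (p ^ C.card * p ^ t) := by
    rw [← nsmul_eq_mul]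
    refine sum_eq_card_nsmul fun Q hQ => ?_
    obtain ⟨h1, h2, h3⟩ := hF Q hQ
    rw [sum_bernoulli_superset (union_subset hC h1), card_union_of_disjoint h2, h3, pow_add]
  rw [hQ, sum_bernoulli_superset hC] at hcover
  linarith

end Finset

open Finset in
/-- Union bound: if each of the conditions indexed by `I` holds in a single sample with probability
at least `q`, then in `N` samples all of them occur with probability at least
`1 - #I * (1 - q) ^ N`. -/
theorem le_bernoulliTupleProb {α ι : Type*} [DecidableEq α] {E : Finset α} {p : ℝ} (hp0 : 0 ≤ p)
    (hp1 : p ≤ 1) {N : ℕ} {A : Set (Fin N → Finset α)} (I : Finset ι) (good : ι → Finset α → Prop)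
    [∀ c, DecidablePred (good c)] {q : ℝ}
    (hq : ∀ c ∈ I, q ≤ ∑ S ∈ E.powerset with good c S, p ^ S.card * (1 - p) ^ (E.card - S.card))
    (hA : ∀ f, (∀ c ∈ I, ∃ i, good c (f i)) → f ∈ A) :
    1 - I.card * (1 - q) ^ N ≤ bernoulliTupleProb E p N A := by
  classical
  set wt : Finset α → ℝ := fun S => p ^ S.card * (1 - p) ^ (E.card - S.card) with hwt
  have hnn : ∀ S, 0 ≤ wt S := fun S => mul_nonneg (pow_nonneg hp0 _) (pow_nonneg (by linarith) _)
  have htot : ∑ S ∈ E.powerset, wt S = 1 := by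
    rw [hwt, sum_pow_mul_eq_add_pow]; simp
  have hbad : ∀ c ∈ I, ∑ f ∈ Fintype.piFinset (fun _ : Fin N => E.powerset),
      (∏ i, if good c (f i) then 0 else wt (f i)) ≤ (1 - q) ^ N := by
    intro c hc
    rw [sum_prod_piFinset E.powerset (fun _ S => if good c S then 0 else wt S)]
    rw [prod_const, card_univ, Fintype.card_fin]
    refine pow_le_pow_left₀ (sum_nonneg fun S _ => by split_ifs <;> simp [hnn]) ?_ N
    have : ∑ S ∈ E.powerset, (if good c S then 0 else wt S) +
        ∑ S ∈ E.powerset with good c S, wt S = 1 := by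
      rw [← htot, sum_filter, ← sum_add_distrib]
      refine sum_congr rfl fun S _ => ?_
      split_ifs <;> simp
    linarith [hq c hc]
  have htuple : ∑ f ∈ Fintype.piFinset (fun _ : Fin N => E.powerset), ∏ i, wt (f i) = 1 := by
    rw [sum_prod_piFinset E.powerset (fun _ S => wt S), htot]; simp
  have hsum : 1 ≤ bernoulliTupleProb E p N A +
      ∑ c ∈ I, ∑ f ∈ Fintype.piFinset (fun _ : Fin N => E.powerset),
        (∏ i, if good c (f i) then 0 else wt (f i)) := by
    rw [← htuple, bernoulliTupleProb, sum_comm, ← sum_add_distrib]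
    refine sum_le_sum fun f _ => ?_
    have hterm : ∀ c ∈ I, 0 ≤ ∏ i, if good c (f i) then 0 else wt (f i) := fun c _ =>
      prod_nonneg fun i _ => by split_ifs <;> simp [hnn]
    by_cases hf : f ∈ A
    · rw [Set.indicator_of_mem hf]
      linarith [sum_nonneg hterm]
    · rw [Set.indicator_of_notMem hf, zero_add]
      obtain ⟨c, hc, hno⟩ : ∃ c ∈ I, ∀ i, ¬ good c (f i) := by
        by_contra! h
        exact hf (hA f h)
      refine le_trans (le_of_eq ?_) (single_le_sum hterm hc)
      exact prod_congr rfl fun i _ => by simp [hno i]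
  have := sum_le_card_nsmul I _ _ hbad
  rw [nsmul_eq_mul] at this
  linarith

namespace SimpleGraph

variable {V : Type*} {G : SimpleGraph V}

theorem card_filter_degree_pos_le [Fintype V] [DecidableRel G.Adj] :
    (Finset.univ.filter fun v => 0 < G.degree v).card ≤ 2 * G.edgeFinset.card := by
  rw [← G.sum_degrees_eq_twice_card_edges, Finset.card_filter]
  exact Finset.sum_le_sum fun v _ => by split_ifs <;> omega

/-- In a graph of girth more than `ℓ`, there is at most one edge set of a path of length at most
`ℓ / 2` per pair of endpoints. -/
theorem exists_edges_of_short_paths [DecidableEq V] {ℓ : ℕ}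
    (hg : ∀ (u : V) (c : G.Walk u u), c.IsCycle → ℓ < c.length) :
    ∃ F : V → V → Finset (Sym2 V), ∀ (a b : V) (q : G.Walk a b), q.IsPath → 2 * q.length ≤ ℓ →
      F a b = q.edges.toFinset := by
  have : ∀ a b : V, ∃ S : Finset (Sym2 V), ∀ q : G.Walk a b, q.IsPath → 2 * q.length ≤ ℓ →
      S = q.edges.toFinset := by
    intro a b
    by_cases h : ∃ q : G.Walk a b, q.IsPath ∧ 2 * q.length ≤ ℓ
    · obtain ⟨q, hq, hl⟩ := h
      refine ⟨q.edges.toFinset, fun q' hq' hl' => ?_⟩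
      rw [hq'.eq_of_length_add_length_le hg hq (by omega)]
    · exact ⟨∅, fun q hq hl => absurd ⟨q, hq, hl⟩ h⟩
  choose F hF using this
  exact ⟨F, hF⟩

theorem Walk.degree_getVert_pos [Fintype V] [DecidableRel G.Adj] {a b : V} (w : G.Walk a b)
    {i : ℕ} (hi : i < w.length) : 0 < G.degree (w.getVert i) :=
  (G.degree_pos_iff_exists_adj _).2 ⟨_, w.adj_getVert_succ hi⟩

/-- There are at most `(2m)²` edge sets of paths of a given length `t ≤ ℓ / 2`. -/
theorem card_short_paths_le [Fintype V] [DecidableEq V] [DecidableRel G.Adj] {ℓ t : ℕ}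
    (hg : ∀ (u : V) (c : G.Walk u u), c.IsCycle → ℓ < c.length) (ht0 : 0 < t) (ht : 2 * t ≤ ℓ)
    (P : Finset (Finset (Sym2 V)))
    (hP : ∀ Q ∈ P, ∃ (a b : V) (q : G.Walk a b), q.IsPath ∧ q.length = t ∧
      Q = q.edges.toFinset) :
    P.card ≤ (2 * G.edgeFinset.card) ^ 2 := by
  obtain ⟨F, hF⟩ := exists_edges_of_short_paths hg
  set U := Finset.univ.filter fun v => 0 < G.degree v
  have hsub : P ⊆ (U ×ˢ U).image fun x => F x.1 x.2 := by
    intro Q hQ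
    obtain ⟨a, b, q, hq, hl, rfl⟩ := hP Q hQ
    refine Finset.mem_image.2 ⟨(a, b), ?_, hF a b q hq (by omega)⟩
    have h1 := q.degree_getVert_pos (i := 0) (by omega)
    have h2 := q.reverse.degree_getVert_pos (i := 0) (by simp; omega)
    rw [Walk.getVert_zero] at h1 h2
    simp [U, h1, h2]
  calc P.card ≤ (U ×ˢ U).card := (Finset.card_le_card hsub).trans Finset.card_image_le
    _ = U.card ^ 2 := by rw [Finset.card_product, sq]
    _ ≤ _ := Nat.pow_le_pow_left card_filter_degree_pos_le 2

/-- There are at most `(2m)³` cycles whose length is close to the girth. -/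
theorem card_short_cycles_le [Fintype V] [DecidableEq V] [DecidableRel G.Adj] {ℓ L : ℕ}
    (hg : ∀ (u : V) (c : G.Walk u u), c.IsCycle → ℓ < c.length) (hL : 2 * (L / 3 + 2) ≤ ℓ)
    (P : Finset (Finset (Sym2 V)))
    (hP : ∀ C ∈ P, IsCycleSet G C ∧ C.card ≤ L) :
    P.card ≤ (2 * G.edgeFinset.card) ^ 3 := by
  obtain ⟨F, hF⟩ := exists_edges_of_short_paths hg
  set U := Finset.univ.filter fun v => 0 < G.degree v
  have hsub : P ⊆ (U ×ˢ U ×ˢ U).image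
      fun x => F x.1 x.2.1 ∪ (F x.2.1 x.2.2 ∪ F x.2.2 x.1) := by
    intro C hC
    obtain ⟨⟨u, w, hw, rfl⟩, hcard⟩ := hP C hC
    rw [List.toFinset_card_of_nodup hw.edges_nodup, Walk.length_edges] at hcard
    have hl := hg u w hw
    set a := w.length / 3
    have ha1 : 0 < a := by have := hw.three_le_length; omega
    refine Finset.mem_image.2 ⟨(u, w.getVert a, (w.drop a).getVert a), ?_, ?_⟩
    · have h1 := w.degree_getVert_pos (i := 0) (by omega)
      have h2 := w.degree_getVert_pos (i := a) (by omega)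
      have h3 := (w.drop a).degree_getVert_pos (i := a) (by rw [Walk.drop_length]; omega)
      rw [Walk.getVert_zero] at h1
      simp only [U, Finset.mem_product, Finset.mem_filter, Finset.mem_univ, true_and]
      exact ⟨h1, h2, h3⟩
    · have hd := hw.isPath_drop ha1
      dsimp only
      rw [hF _ _ (w.take a) (hw.isPath_take (by omega)) (by rw [Walk.take_length]; omega),
        hF _ _ ((w.drop a).take a) (hd.take a) (by rw [Walk.take_length]; omega),
        hF _ _ ((w.drop a).drop a) (hd.drop a) (by simp only [Walk.drop_length]; omega),
        ← List.toFinset_append, ← List.toFinset_append, ← Walk.edges_append,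
        Walk.append_take_drop_eq, ← Walk.edges_append, Walk.append_take_drop_eq]
  calc P.card ≤ (U ×ˢ U ×ˢ U).card := (Finset.card_le_card hsub).trans Finset.card_image_le
    _ = U.card ^ 3 := by rw [Finset.card_product, Finset.card_product]; ring
    _ ≤ _ := Nat.pow_le_pow_left card_filter_degree_pos_le 3

end SimpleGraph

/-- If `G` has exactly `m ≥ 2` edges, no cycle of length `≤ ℓ`, and `p^ℓ = 1/m^100`, then with
probability at least `1 - (2m)^4·(1 - 1/(2m^101))^(m^102)`, among `m^102` independent
Bernoulli(p) samples of the edge set, every cycle of length in `(ℓ, 1.01·ℓ]` is the unique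
surviving cycle of some sample. -/
theorem all_short_cycles_isolated_prob {V : Type*} [Fintype V] [DecidableEq V]
    (G : SimpleGraph V) [DecidableRel G.Adj] (m ℓ : ℕ) (hm : 2 ≤ m)
    (hedges : G.edgeFinset.card = m)
    (hgirth : ∀ C : Finset (Sym2 V), IsCycleSet G C → ℓ < C.card)
    (p : ℝ) (hp0 : 0 ≤ p) (hp1 : p ≤ 1) (hpl : p ^ ℓ = 1 / (m : ℝ) ^ 100) :
    1 - (2 * (m : ℝ)) ^ 4 * (1 - 1 / (2 * (m : ℝ) ^ 101)) ^ (m ^ 102) ≤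
      bernoulliTupleProb G.edgeFinset p (m ^ 102)
        {f | ∀ C : Finset (Sym2 V), IsCycleSet G C → ℓ < C.card → (C.card : ℝ) ≤ 1.01 * ℓ →
          ∃ i : Fin (m ^ 102), C ⊆ f i ∧
            ∀ C' : Finset (Sym2 V), IsCycleSet G C' → C' ≠ C → ¬ C' ⊆ f i} := by
  classical
  have hg : ∀ (u : V) (c : G.Walk u u), c.IsCycle → ℓ < c.length := fun u c hc => by
    have := hgirth _ ⟨u, c, hc, rfl⟩
    rwa [List.toFinset_card_of_nodup hc.edges_nodup, SimpleGraph.Walk.length_edges] at this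
  have hmR : (2 : ℝ) ≤ m := by exact_mod_cast hm
  have hsubE : ∀ {a b : V} (q : G.Walk a b), q.edges.toFinset ⊆ G.edgeFinset := fun q e he =>
    SimpleGraph.mem_edgeFinset.2 (q.edges_subset_edgeSet (List.mem_toFinset.1 he))
  have hmono : ∀ {l l' : List (Sym2 V)}, l ⊆ l' → l.toFinset ⊆ l'.toFinset := fun h e he =>
    List.mem_toFinset.2 (h (List.mem_toFinset.1 he))
  set I : Finset (Finset (Sym2 V)) := Finset.univ.filter fun C =>
    IsCycleSet G C ∧ ℓ < C.card ∧ (C.card : ℝ) ≤ 1.01 * ℓ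
  have hIlen : ∀ C ∈ I, IsCycleSet G C ∧ ℓ < C.card ∧ 100 * C.card ≤ 101 * ℓ := fun C hC => by
    obtain ⟨h1, h2, h3⟩ := (Finset.mem_filter.1 hC).2
    refine ⟨h1, h2, ?_⟩
    have : (100 * C.card : ℝ) ≤ 101 * ℓ := by linarith
    exact_mod_cast this
  have hIcard : (I.card : ℝ) ≤ (2 * (m : ℝ)) ^ 4 := by
    rcases I.eq_empty_or_nonempty with hemp | ⟨C₀, hC₀⟩
    · rw [hemp]; simp
    · obtain ⟨-, h2, h3⟩ := hIlen C₀ hC₀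
      have := SimpleGraph.card_short_cycles_le hg (L := 101 * ℓ / 100) (by omega) I fun C hC =>
        ⟨(hIlen C hC).1, by have := (hIlen C hC).2.2; omega⟩
      rw [hedges] at this
      calc (I.card : ℝ) ≤ (2 * (m : ℝ)) ^ 3 := by exact_mod_cast this
        _ ≤ _ := pow_le_pow_right₀ (by linarith) (by norm_num)
  set good : Finset (Sym2 V) → Finset (Sym2 V) → Prop := fun C S =>
    C ⊆ S ∧ ∀ C' : Finset (Sym2 V), IsCycleSet G C' → C' ≠ C → ¬ C' ⊆ S
  have hsingle : ∀ C ∈ I, 1 / (2 * (m : ℝ) ^ 101) ≤ ∑ S ∈ G.edgeFinset.powerset with good C S,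
      p ^ S.card * (1 - p) ^ (G.edgeFinset.card - S.card) := by
    intro C hC
    obtain ⟨hcyc, hlt, hle⟩ := hIlen C hC
    obtain ⟨u, c, hc, rfl⟩ := hcyc
    have hcard : c.edges.toFinset.card = c.length := by
      rw [List.toFinset_card_of_nodup hc.edges_nodup, SimpleGraph.Walk.length_edges]
    set t := ℓ / 3
    set F : Finset (Finset (Sym2 V)) := Finset.univ.filter fun Q =>
      Disjoint c.edges.toFinset Q ∧
        ∃ (a b : V) (q : G.Walk a b), q.IsPath ∧ q.length = t ∧ Q = q.edges.toFinset
    have hFcard : (F.card : ℝ) ≤ (2 * (m : ℝ)) ^ 2 := by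
      have := SimpleGraph.card_short_paths_le hg (t := t) (by omega) (by omega) F fun Q hQ =>
        (Finset.mem_filter.1 hQ).2.2
      rw [hedges] at this
      exact_mod_cast this
    have hmain := Finset.le_sum_bernoulli_superset_avoiding (hsubE c) hp0 hp1 (t := t) F
      (fun Q hQ => by
        obtain ⟨hd, a, b, q, hq, hl, rfl⟩ := (Finset.mem_filter.1 hQ).2
        exact ⟨hsubE q, hd, by
          rw [List.toFinset_card_of_nodup hq.edges_nodup, SimpleGraph.Walk.length_edges, hl]⟩)
      (good c.edges.toFinset) (fun S _ hCS hno => by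
        refine ⟨hCS, ?_⟩
        rintro _ ⟨v, w, hw, rfl⟩ hne hwS
        have hwc : ¬ w.edges ⊆ c.edges := fun hwc => by
          have hcw : ¬ c.edges ⊆ w.edges := fun hcw =>
            hne (List.toFinset.ext fun e => ⟨fun h => hwc h, fun h => hcw h⟩)
          have hwl : w.length ≤ c.length := by
            have := Finset.card_le_card (hmono hwc)
            rwa [hcard, List.toFinset_card_of_nodup hw.edges_nodup,
              SimpleGraph.Walk.length_edges] at this
          obtain ⟨a, b, q, hq, hql, hqc, hqw⟩ := SimpleGraph.Walk.IsCycle.exists_isPath_avoiding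
            hg w (t := t) (by omega) hc hcw
          have hdisj : Disjoint w.edges.toFinset q.edges.toFinset :=
            Finset.disjoint_right.2 fun e he => by simpa using hqw e (by simpa using he)
          have := Finset.card_le_card (Finset.union_subset
            (hmono hwc) (hmono hqc))
          rw [Finset.card_union_of_disjoint hdisj, hcard,
            List.toFinset_card_of_nodup hw.edges_nodup,
            List.toFinset_card_of_nodup hq.edges_nodup, SimpleGraph.Walk.length_edges,
            SimpleGraph.Walk.length_edges] at this
          have := hg v w hw
          omega
        obtain ⟨a, b, q, hq, hql, hqw, hqc⟩ := SimpleGraph.Walk.IsCycle.exists_isPath_avoiding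
          hg c (t := t) (by omega) hw hwc
        refine hno q.edges.toFinset (Finset.mem_filter.2 ⟨Finset.mem_univ _, ?_, a, b, q, hq, hql,
          rfl⟩) ((hmono hqw).trans hwS)
        exact Finset.disjoint_right.2 fun e he => by simpa using hqc e (by simpa using he))
    refine le_trans ?_ hmain
    have hm0 : (0 : ℝ) < m := by linarith
    have hpC : 1 / (m : ℝ) ^ 101 ≤ p ^ c.edges.toFinset.card := by
      refine le_of_pow_le_pow_left₀ (n := 100) (by norm_num) (pow_nonneg hp0 _) ?_
      calc (1 / (m : ℝ) ^ 101) ^ 100 = (p ^ ℓ) ^ 101 := by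
            rw [hpl, div_pow, div_pow, ← pow_mul, ← pow_mul, one_pow, one_pow]
        _ = p ^ (101 * ℓ) := by rw [← pow_mul, mul_comm]
        _ ≤ p ^ (100 * c.edges.toFinset.card) := pow_le_pow_of_le_one hp0 hp1 hle
        _ = _ := by rw [← pow_mul, mul_comm]
    have hpt : p ^ t ≤ 1 / (m : ℝ) ^ 25 := by
      refine le_of_pow_le_pow_left₀ (n := 4) (by norm_num) (by positivity) ?_
      calc (p ^ t) ^ 4 = p ^ (t * 4) := by rw [← pow_mul]
        _ ≤ p ^ ℓ := pow_le_pow_of_le_one hp0 hp1 (by omega)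
        _ = _ := by rw [hpl, div_pow, ← pow_mul, one_pow]
    have hFp : F.card * p ^ t ≤ 1 / 2 := by
      calc F.card * p ^ t ≤ (2 * (m : ℝ)) ^ 2 * (1 / (m : ℝ) ^ 25) := by gcongr
        _ = 4 / (m : ℝ) ^ 23 := by field_simp; norm_num
        _ ≤ 4 / 2 ^ 23 := by gcongr
        _ ≤ 1 / 2 := by norm_num
    calc 1 / (2 * (m : ℝ) ^ 101) = 1 / (m : ℝ) ^ 101 * (1 / 2) := by field_simp
      _ ≤ _ := mul_le_mul hpC (by linarith) (by norm_num) (pow_nonneg hp0 _)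
  refine le_trans ?_ (le_bernoulliTupleProb hp0 hp1 I good hsingle ?_)
  · have h1 : 1 / (2 * (m : ℝ) ^ 101) ≤ 1 := by
      rw [div_le_one (by positivity)]
      nlinarith [one_le_pow₀ (n := 101) (show (1 : ℝ) ≤ m by linarith)]
    have h2 : 0 ≤ (1 - 1 / (2 * (m : ℝ) ^ 101)) ^ (m ^ 102) := pow_nonneg (by linarith) _
    have := mul_le_mul_of_nonneg_right hIcard h2
    linarith
  · intro f hf C hcyc hlt hle
    exact hf C (Finset.mem_filter.2 ⟨Finset.mem_univ _, hcyc, hlt, hle⟩)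
end

section
/- Let m ≥ 2 and ℓ ≥ 1 be integers. There exist subsets B_1, …, B_{m^{200}} of the label set {1, …, m} with the following property: for every simple graph G on at most 2m vertices whose edge set has exactly m edges and is injectively labeled by {1, …, m}, if G contains no cycle of length strictly less than ℓ, then for every cycle C of G of length at most 1.01·ℓ there is an index i ∈ [m^{200}] such that every label of an edge of C lies in B_i, while for every cycle C' ≠ C of G at least one label of an edge of C' lies outside B_i (i.e., C is the unique cycle of G whose label set is contained in B_i). -/
open Finset in
/-- Greedy covering: if every `i` is hit by a random `ω` with probability at least `p`, then
`N` suitably chosen points hit all of `U` as soon as `#U * (1 - p) ^ N < 1`. -/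
theorem exists_hitting_family {I Ω : Type*} [Fintype Ω] (good : I → Ω → Prop) (w : Ω → ℝ)
    (hw : ∀ ω, 0 ≤ w ω) (hw1 : ∑ ω, w ω = 1) (p : ℝ) (hp : p ≤ 1)
    [∀ i ω, Decidable (good i ω)] (N : ℕ) (U : Finset I)
    (hU : ∀ i ∈ U, p ≤ ∑ ω, if good i ω then w ω else 0)
    (hN : (#U : ℝ) * (1 - p) ^ N < 1) :
    ∃ B : Fin N → Ω, ∀ i ∈ U, ∃ j, good i (B j) := by
  induction N generalizing U with
  | zero =>
    have h0 : U = ∅ := by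
      rw [← card_eq_zero]
      have : (#U : ℝ) < 1 := by simpa using hN
      exact_mod_cast Nat.lt_one_iff.mp (by exact_mod_cast this)
    exact ⟨Fin.elim0, by simp [h0]⟩
  | succ N ih =>
    obtain ⟨ω, hω⟩ : ∃ ω, (#(U.filter fun i => ¬ good i ω) : ℝ) ≤ (1 - p) * #U := by
      by_contra! hcon
      have hsum : ∑ ω, w ω * (#(U.filter fun i => ¬ good i ω) : ℝ) ≤ (1 - p) * #U := by
        calc ∑ ω, w ω * (#(U.filter fun i => ¬ good i ω) : ℝ)
            = ∑ i ∈ U, ∑ ω, (w ω - if good i ω then w ω else 0) := by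
              rw [sum_comm]
              refine sum_congr rfl fun ω _ => ?_
              rw [card_filter, Nat.cast_sum, mul_sum]
              refine sum_congr rfl fun i _ => ?_
              by_cases h : good i ω <;> simp [h]
          _ ≤ ∑ i ∈ U, (1 - p) := by
              refine sum_le_sum fun i hi => ?_
              rw [sum_sub_distrib, hw1]
              linarith [hU i hi]
          _ = (1 - p) * #U := by rw [sum_const, nsmul_eq_mul, mul_comm]
      obtain ⟨ω₀, hω₀⟩ : ∃ ω, 0 < w ω := by
        by_contra! h
        have : ∑ ω, w ω ≤ 0 := sum_nonpos fun ω _ => h ω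
        linarith
      have hlt : ∑ ω, w ω * ((1 - p) * #U) <
          ∑ ω, w ω * (#(U.filter fun i => ¬ good i ω) : ℝ) :=
        sum_lt_sum (fun ω _ => mul_le_mul_of_nonneg_left (hcon ω).le (hw ω))
          ⟨ω₀, mem_univ _, mul_lt_mul_of_pos_left (hcon ω₀) hω₀⟩
      rw [← sum_mul, hw1, one_mul] at hlt
      linarith
    obtain ⟨B, hB⟩ := ih (U.filter fun i => ¬ good i ω)
      (fun i hi => hU i (mem_filter.mp hi).1) (by
        refine lt_of_le_of_lt ?_ hN
        rw [pow_succ']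
        calc _ ≤ ((1 - p) * #U) * (1 - p) ^ N :=
              mul_le_mul_of_nonneg_right hω (pow_nonneg (by linarith) _)
          _ = _ := by ring)
    refine ⟨Fin.cons ω B, fun i hi => ?_⟩
    by_cases h : good i ω
    · exact ⟨0, by simpa using h⟩
    · obtain ⟨j, hj⟩ := hB i (mem_filter.mpr ⟨hi, h⟩)
      exact ⟨j.succ, by simpa using hj⟩

open Finset in
/-- The probability that a random subset, containing every element independently with
probability `q`, is equal to `B`. -/
noncomputable def bernoulliWeight {α : Type*} [Fintype α] [DecidableEq α] (q : ℝ)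
    (B : Finset α) : ℝ :=
  (∏ _i ∈ B, q) * ∏ _i ∈ univ \ B, (1 - q)

open Finset in
/-- The random subset contains `S` with probability `q ^ #S`. -/
theorem sum_bernoulliWeight_superset {α : Type*} [Fintype α] [DecidableEq α] (q : ℝ)
    (S : Finset α) :
    ∑ B : Finset α, (if S ⊆ B then bernoulliWeight q B else 0) = q ^ #S := by
  have h := prod_add (fun _ : α => q) (fun i => if i ∈ S then 0 else 1 - q) univ
  have hl : ∏ i : α, (q + if i ∈ S then 0 else 1 - q) = q ^ #S := by
    rw [← prod_const, ← prod_subset (subset_univ S)]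
    · exact prod_congr rfl fun i hi => by simp [hi]
    · intro i _ hi
      simp [hi]
  rw [← hl, h, powerset_univ]
  refine sum_congr rfl fun B _ => ?_
  split_ifs with hS
  · unfold bernoulliWeight
    congr 1
    refine prod_congr rfl fun i hi => ?_
    have : i ∉ S := fun hi' => (mem_sdiff.mp hi).2 (hS hi')
    simp [this]
  · obtain ⟨i, hi, hiB⟩ := not_subset.mp hS
    rw [prod_eq_zero (s := univ \ B) (i := i) (by simp [hiB]) (by simp [hi]), mul_zero]

open Finset in
/-- A random subset contains `K` and none of the large sets `P j` disjoint from `K` with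
probability at least `m ^ (-41)`. -/
theorem le_sum_bernoulliWeight_isolating {m ℓ : ℕ} (hm : 2 ≤ m) (q : ℝ) (hq0 : 0 ≤ q)
    (hq1 : q ≤ 1) (hq : q ^ ℓ = ((m : ℝ)⁻¹ ^ 5) ^ 4) (K : Finset (Fin m)) (hK : #K ≤ 2 * ℓ)
    (P : Fin (2 * m) × Fin (2 * m) → Finset (Fin m)) :
    (m : ℝ)⁻¹ ^ 41 ≤ ∑ B : Finset (Fin m),
      if K ⊆ B ∧ ∀ j, ℓ ≤ 4 * #(P j) → Disjoint (P j) K → ¬ P j ⊆ B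
      then bernoulliWeight q B else 0 := by
  have hw (B : Finset (Fin m)) : 0 ≤ bernoulliWeight q B :=
    mul_nonneg (prod_nonneg fun _ _ => hq0) (prod_nonneg fun _ _ => by linarith)
  have hm0 : (2 : ℝ) ≤ m := by exact_mod_cast hm
  set x : ℝ := (m : ℝ)⁻¹ with hx
  have hx0 : 0 < x := by positivity
  have hmx : (m : ℝ) * x = 1 := mul_inv_cancel₀ (by positivity)
  have hx2 : x ≤ 1 / 2 := by nlinarith
  let J := univ.filter fun j => ℓ ≤ 4 * #(P j) ∧ Disjoint (P j) K
  have hlarge : ∀ j ∈ J, q ^ #(K ∪ P j) ≤ q ^ #K * x ^ 5 := by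
    intro j hj
    obtain ⟨hj1, hj2⟩ := (mem_filter.mp hj).2
    rw [card_union_of_disjoint hj2.symm, pow_add]
    refine mul_le_mul_of_nonneg_left ?_ (pow_nonneg hq0 _)
    refine le_of_pow_le_pow_left₀ (n := 4) (by norm_num) (by positivity) ?_
    rw [← hq, ← pow_mul]
    exact pow_le_pow_of_le_one hq0 hq1 (by omega)
  have hcard : (#J : ℝ) ≤ 4 * m ^ 2 := by
    have : #J ≤ (2 * m) * (2 * m) := by
      simpa using card_le_univ J
    calc (#J : ℝ) ≤ ((2 * m) * (2 * m) : ℕ) := by exact_mod_cast this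
      _ = _ := by push_cast; ring
  have hsplit : ∑ B : Finset (Fin m), (if K ⊆ B then bernoulliWeight q B else 0) ≤
      (∑ B : Finset (Fin m), if K ⊆ B ∧ ∀ j, ℓ ≤ 4 * #(P j) → Disjoint (P j) K → ¬ P j ⊆ B
        then bernoulliWeight q B else 0) +
      ∑ j ∈ J, ∑ B : Finset (Fin m), if K ∪ P j ⊆ B then bernoulliWeight q B else 0 := by
    rw [sum_comm, ← sum_add_distrib]
    refine sum_le_sum fun B _ => ?_
    have hnn : ∀ j ∈ J, 0 ≤ if K ∪ P j ⊆ B then bernoulliWeight q B else 0 := fun j _ => by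
      split_ifs
      exacts [hw B, le_rfl]
    by_cases hKB : K ⊆ B
    · by_cases hgood : ∀ j, ℓ ≤ 4 * #(P j) → Disjoint (P j) K → ¬ P j ⊆ B
      · rw [if_pos hKB, if_pos ⟨hKB, hgood⟩]
        exact le_add_of_nonneg_right (sum_nonneg hnn)
      · rw [if_pos hKB, if_neg fun h => hgood h.2, zero_add]
        push Not at hgood
        obtain ⟨j, h1, h2, h3⟩ := hgood
        refine le_trans ?_ (single_le_sum hnn (mem_filter.mpr ⟨mem_univ j, h1, h2⟩))
        rw [if_pos (union_subset hKB h3)]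
    · rw [if_neg hKB, if_neg fun h => hKB h.1, zero_add]
      exact sum_nonneg hnn
  simp only [sum_bernoulliWeight_superset] at hsplit
  have hbad : ∑ j ∈ J, q ^ #(K ∪ P j) ≤ q ^ #K * (1 / 2) := by
    have h4 : 4 * (m : ℝ) ^ 2 * x ^ 5 ≤ 1 / 2 := by
      have : 4 * (m : ℝ) ^ 2 * x ^ 5 = 4 * (m * x) ^ 2 * x ^ 3 := by ring
      have h3 : x ^ 3 ≤ (1 / 2) ^ 3 := pow_le_pow_left₀ hx0.le hx2 3
      rw [this, hmx]
      linarith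
    calc ∑ j ∈ J, q ^ #(K ∪ P j) ≤ #J * (q ^ #K * x ^ 5) := by
          simpa using sum_le_card_nsmul J _ _ hlarge
      _ ≤ 4 * m ^ 2 * (q ^ #K * x ^ 5) := by gcongr
      _ = q ^ #K * (4 * m ^ 2 * x ^ 5) := by ring
      _ ≤ _ := by gcongr
  have hmain : x ^ 40 ≤ q ^ #K := by
    calc x ^ 40 = q ^ (2 * ℓ) := by rw [mul_comm, pow_mul, hq]; ring
      _ ≤ q ^ #K := pow_le_pow_of_le_one hq0 hq1 hK
  have : x ^ 41 ≤ x ^ 40 * (1 / 2) := by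
    rw [pow_succ]
    gcongr
  linarith

open Finset in
/-- There are `m ^ 200` sets of labels such that every small `K` is contained in one of them
which contains none of `(2 * m) ^ 2` given large sets disjoint from `K`. -/
theorem exists_isolating_family (m ℓ : ℕ) (hm : 2 ≤ m) (hℓ : 1 ≤ ℓ) :
    ∃ B : Fin (m ^ 200) → Finset (Fin m), ∀ K : Finset (Fin m), #K ≤ 2 * ℓ →
      ∀ P : Fin (2 * m) × Fin (2 * m) → Finset (Fin m), ∃ i, K ⊆ B i ∧
        ∀ j, ℓ ≤ 4 * #(P j) → Disjoint (P j) K → ¬ P j ⊆ B i := by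
  have hm0 : (2 : ℝ) ≤ m := by exact_mod_cast hm
  set x : ℝ := (m : ℝ)⁻¹ with hx
  have hx0 : 0 < x := by positivity
  have hmx : (m : ℝ) * x = 1 := mul_inv_cancel₀ (by positivity)
  have hx1 : x ≤ 1 := by nlinarith
  obtain ⟨q, hq0, hq⟩ : ∃ q : ℝ, 0 ≤ q ∧ q ^ ℓ = (x ^ 5) ^ 4 :=
    ⟨((x ^ 5) ^ 4) ^ ((ℓ : ℝ)⁻¹), by positivity,
      Real.rpow_inv_natCast_pow (by positivity) (by omega)⟩
  have hq1 : q ≤ 1 := by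
    refine le_of_pow_le_pow_left₀ (n := ℓ) (by omega) zero_le_one ?_
    rw [hq, one_pow, ← pow_mul]
    exact pow_le_one₀ hx0.le hx1
  let U : Finset (Finset (Fin m) × (Fin (2 * m) × Fin (2 * m) → Finset (Fin m))) :=
    univ.filter fun a => #a.1 ≤ 2 * ℓ
  obtain ⟨B, hB⟩ := exists_hitting_family
    (fun (a : Finset (Fin m) × (Fin (2 * m) × Fin (2 * m) → Finset (Fin m))) B =>
      a.1 ⊆ B ∧ ∀ j, ℓ ≤ 4 * #(a.2 j) → Disjoint (a.2 j) a.1 → ¬ a.2 j ⊆ B)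
    (bernoulliWeight q)
    (fun B => mul_nonneg (prod_nonneg fun _ _ => hq0) (prod_nonneg fun _ _ => by linarith))
    (by simpa using sum_bernoulliWeight_superset q (∅ : Finset (Fin m)))
    (x ^ 41) (pow_le_one₀ hx0.le hx1) (m ^ 200) U
    (fun a ha => le_sum_bernoulliWeight_isolating hm q hq0 hq1 hq a.1 (mem_filter.mp ha).2 a.2)
    (by
      have hcard : (#U : ℝ) ≤ 2 ^ (m + 4 * m ^ 3) := by
        have : #U ≤ 2 ^ (m + 4 * m ^ 3) := by
          refine (card_le_univ U).trans (le_of_eq ?_)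
          simp only [Fintype.card_prod, Fintype.card_finset, Fintype.card_fin, Fintype.card_fun]
          rw [← pow_mul, ← pow_add]
          congr 1
          ring
        exact_mod_cast this
      have hexp : (m + 4 * m ^ 3 : ℝ) < m ^ 159 := by
        have h6 : (m : ℝ) ^ 6 ≤ m ^ 159 := pow_le_pow_right₀ (by linarith) (by norm_num)
        have h3 : (8 : ℝ) ≤ m ^ 3 := by
          calc (8 : ℝ) = 2 ^ 3 := by norm_num
            _ ≤ _ := by gcongr
        have h1 : (m : ℝ) ≤ m ^ 3 := le_self_pow₀ (by linarith) (by norm_num)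
        nlinarith
      have hN : (1 - x ^ 41) ^ m ^ 200 ≤ Real.exp (-(m ^ 159 : ℝ)) := by
        have hpow : (m : ℝ) ^ 200 * x ^ 41 = m ^ 159 := by
          calc (m : ℝ) ^ 200 * x ^ 41 = m ^ 159 * (m * x) ^ 41 := by ring
            _ = _ := by rw [hmx, one_pow, mul_one]
        calc (1 - x ^ 41) ^ m ^ 200 ≤ Real.exp (-x ^ 41) ^ m ^ 200 :=
              pow_le_pow_left₀ (sub_nonneg.mpr (pow_le_one₀ hx0.le hx1))
                (Real.one_sub_le_exp_neg _) _
          _ = _ := by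
              rw [← Real.exp_nat_mul, ← hpow]
              push_cast
              ring_nf
      have h2 : (2 : ℝ) ^ (m + 4 * m ^ 3) ≤ Real.exp (m + 4 * m ^ 3 : ℝ) := by
        calc (2 : ℝ) ^ (m + 4 * m ^ 3) ≤ Real.exp 1 ^ (m + 4 * m ^ 3) := by
              gcongr
              linarith [Real.add_one_le_exp 1]
          _ = _ := by
              rw [← Real.exp_nat_mul]
              push_cast
              ring_nf
      calc (#U : ℝ) * (1 - x ^ 41) ^ m ^ 200
          ≤ Real.exp (m + 4 * m ^ 3 : ℝ) * Real.exp (-(m ^ 159 : ℝ)) :=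
            mul_le_mul (hcard.trans h2) hN
              (pow_nonneg (sub_nonneg.mpr (pow_le_one₀ hx0.le hx1)) _) (Real.exp_pos _).le
        _ < 1 := by
            rw [← Real.exp_add, Real.exp_lt_one_iff]
            linarith)
  exact ⟨B, fun K hK P => hB (K, P) (mem_filter.mpr ⟨mem_univ _, hK⟩)⟩

namespace SimpleGraph

theorem Walk.IsCycle.card_toFinset_edges {V : Type*} [DecidableEq V] {G : SimpleGraph V}
    {u : V} {c : G.Walk u u} (hc : c.IsCycle) :
    c.edges.toFinset.card = c.length := by
  rw [List.toFinset_card_of_nodup hc.edges_nodup, Walk.length_edges]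

/-- The union of two distinct paths with the same endpoints contains a cycle. -/
theorem Walk.IsPath.exists_isCycleSet_s16 {V : Type*} [DecidableEq V] {G : SimpleGraph V}
    {x y : V} {p q : G.Walk x y} (hp : p.IsPath)
    (hq : q.IsPath) (hne : p ≠ q) :
    ∃ C, IsCycleSet G C ∧ C.card ≤ p.length + q.length := by
  let F : Finset (Sym2 V) := p.edges.toFinset ∪ q.edges.toFinset
  have hFG : ∀ e ∈ F, e ∈ G.edgeSet := by
    intro e he
    rcases Finset.mem_union.mp he with h | h
    · exact p.edges_subset_edgeSet (List.mem_toFinset.mp h)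
    · exact q.edges_subset_edgeSet (List.mem_toFinset.mp h)
  let H : SimpleGraph V := .fromEdgeSet F
  have hH : ∀ e, e ∈ H.edgeSet ↔ e ∈ F := by
    intro e
    simp only [H, edgeSet_fromEdgeSet, Set.mem_sdiff, Finset.mem_coe]
    exact ⟨And.left, fun h => ⟨h, G.not_isDiag_of_mem_edgeSet (hFG e h)⟩⟩
  have hHG : H ≤ G := edgeSet_subset_edgeSet.mp fun e he => hFG e ((hH e).mp he)
  have hpH : ∀ e ∈ p.edges, e ∈ H.edgeSet := fun e he => (hH e).mpr (by simp [F, he])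
  have hqH : ∀ e ∈ q.edges, e ∈ H.edgeSet := fun e he => (hH e).mpr (by simp [F, he])
  have hcyc : ¬ H.IsAcyclic := by
    intro hac
    have h := (hac.subsingleton_path x y).elim ⟨_, hp.transfer hpH⟩ ⟨_, hq.transfer hqH⟩
    have h' : (p.transfer H hpH).edges = (q.transfer H hqH).edges := by
      rw [Subtype.mk.inj h]
    rw [Walk.edges_transfer, Walk.edges_transfer] at h'
    exact hne (Walk.edges_injective h')
  simp only [IsAcyclic, not_forall, not_not] at hcyc
  obtain ⟨v, c, hc⟩ := hcyc
  refine ⟨_, ⟨v, c.mapLe hHG, hc.mapLe hHG, rfl⟩, ?_⟩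
  rw [Walk.edges_mapLe_eq_edges]
  calc c.edges.toFinset.card ≤ F.card := Finset.card_le_card fun e he =>
        (hH e).mp (c.edges_subset_edgeSet (List.mem_toFinset.mp he))
    _ ≤ p.edges.toFinset.card + q.edges.toFinset.card := Finset.card_union_le _ _
    _ ≤ p.edges.length + q.edges.length :=
        add_le_add (List.toFinset_card_le _) (List.toFinset_card_le _)
    _ = _ := by rw [Walk.length_edges, Walk.length_edges]

/-- A path does not contain all edges of a cycle. -/
theorem Walk.IsPath.not_isCycle_edges_subset {V : Type*} [DecidableEq V] {G : SimpleGraph V}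
    {x y v : V} {p : G.Walk x y} (hp : p.IsPath)
    {c : G.Walk v v} (hc : c.IsCycle) : ¬ c.edges ⊆ p.edges := by
  induction p with
  | nil =>
    intro h
    have := hc.three_le_length
    rw [Walk.edges_nil, List.subset_nil] at h
    rw [← Walk.length_edges, h] at this
    simp at this
  | @cons u w y hadj p ih =>
    intro h
    rw [Walk.cons_isPath_iff] at hp
    by_cases hmem : s(u, w) ∈ c.edges
    · have hu : u ∈ c.support := c.fst_mem_support_of_mem_edges hmem
      have hr := hc.rotate hu
      have huniq : ∀ a, s(u, a) ∈ (c.rotate u hu).edges → a = w := by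
        intro a ha
        have ha' := h ((c.rotate_edges u hu).mem_iff.mp ha)
        rw [Walk.edges_cons, List.mem_cons] at ha'
        rcases ha' with h' | h'
        · exact Sym2.congr_right.mp h'
        · exact absurd (p.fst_mem_support_of_mem_edges h') hp.2
      refine hr.snd_ne_penultimate ?_
      rw [huniq _ (Walk.mk_start_snd_mem_edges hr.not_nil), huniq (c.rotate u hu).penultimate]
      rw [Sym2.eq_swap]
      exact Walk.mk_penultimate_end_mem_edges hr.not_nil
    · refine ih hp.1 fun e he => ?_
      have := h he
      rw [Walk.edges_cons, List.mem_cons] at this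
      rcases this with rfl | h'
      · exact absurd he hmem
      · exact h'

/-- Deleting an edge from a cycle leaves a path between the two ends of that edge. -/
theorem Walk.IsCycle.exists_isPath_of_mem_edges_s16 {V : Type*} [DecidableEq V] {G : SimpleGraph V}
    {v a b : V} {c : G.Walk v v} (hc : c.IsCycle)
    (hf : s(a, b) ∈ c.edges) :
    ∃ p : G.Walk b a, p.IsPath ∧ ∀ e, e ∈ c.edges ↔ e = s(a, b) ∨ e ∈ p.edges := by
  obtain ⟨r, hr, hre, hsnd⟩ : ∃ r : G.Walk a a, r.IsCycle ∧ (∀ e, e ∈ r.edges ↔ e ∈ c.edges) ∧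
      r.snd = b := by
    have ha : a ∈ c.support := c.fst_mem_support_of_mem_edges hf
    have hr := hc.rotate ha
    have hre : ∀ e, e ∈ (c.rotate a ha).edges ↔ e ∈ c.edges :=
      fun e => (c.rotate_edges a ha).mem_iff
    by_cases hsnd : (c.rotate a ha).snd = b
    · exact ⟨_, hr, hre, hsnd⟩
    · refine ⟨(c.rotate a ha).reverse, hr.reverse, fun e => by simp [hre], ?_⟩
      rw [Walk.snd_reverse]
      have hmem := (hre _).mpr hf
      rw [← Walk.cons_tail_eq _ hr.not_nil, Walk.edges_cons, List.mem_cons] at hmem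
      rcases hmem with h | h
      · exact absurd (Sym2.congr_right.mp h).symm hsnd
      · have hp := hr.isPath_tail
        have hb := hp.eq_penultimate_of_mem_edges h
        have hnil : ¬ (c.rotate a ha).tail.Nil := by
          rw [Walk.not_nil_iff_lt_length]
          have := Walk.length_tail_add_one hr.not_nil
          have := hr.three_le_length
          omega
        rw [hb, ← Walk.penultimate_cons_of_not_nil ((c.rotate a ha).adj_snd hr.not_nil) _ hnil,
          Walk.cons_tail_eq _ hr.not_nil]
  subst hsnd
  refine ⟨r.tail, hr.isPath_tail, fun e => ?_⟩
  rw [← hre]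
  conv_lhs => rw [← Walk.cons_tail_eq r hr.not_nil]
  rw [Walk.edges_cons, List.mem_cons]

/-- A walk ending in `S` has an initial segment which avoids `F` and ends in `S`, provided that
`S` contains all ends of edges in `F`. -/
theorem Walk.exists_append_avoiding {V : Type*} {G : SimpleGraph V}
    (F : Set (Sym2 V)) (S : Set V)
    (hFS : ∀ e ∈ F, ∀ v ∈ e, v ∈ S) {x y : V} (p : G.Walk x y) (hy : y ∈ S) :
    ∃ z ∈ S, ∃ (q : G.Walk x z) (r : G.Walk z y), p = q.append r ∧ ∀ e ∈ q.edges, e ∉ F := by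
  induction p with
  | nil => exact ⟨_, hy, .nil, .nil, rfl, by simp⟩
  | @cons u w y hadj p ih =>
    by_cases hF : s(u, w) ∈ F
    · exact ⟨u, hFS _ hF u (by simp), .nil, .cons hadj p, rfl, by simp⟩
    · obtain ⟨z, hz, q, r, rfl, hq⟩ := ih hy
      refine ⟨z, hz, .cons hadj q, r, rfl, fun e he => ?_⟩
      rw [Walk.edges_cons, List.mem_cons] at he
      rcases he with rfl | he
      exacts [hF, hq e he]

/-- A path with ends in `S` and an edge outside `F` contains an `F`-avoiding subpath with ends
in `S`, provided that `S` contains all ends of edges in `F`. -/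
theorem Walk.IsPath.exists_avoiding_subpath {V : Type*} {G : SimpleGraph V}
    (F : Set (Sym2 V)) (S : Set V)
    (hFS : ∀ e ∈ F, ∀ v ∈ e, v ∈ S) {x y : V} {p : G.Walk x y} (hp : p.IsPath) (hx : x ∈ S)
    (hy : y ∈ S) {e : Sym2 V} (he : e ∈ p.edges) (heF : e ∉ F) :
    ∃ a ∈ S, ∃ b ∈ S, ∃ q : G.Walk a b, q.IsPath ∧ 1 ≤ q.length ∧ (∀ e ∈ q.edges, e ∉ F) ∧
      q.edges ⊆ p.edges := by
  induction p with
  | nil => simp at he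
  | @cons u w y hadj p ih =>
    by_cases hF : s(u, w) ∈ F
    · rw [Walk.edges_cons, List.mem_cons] at he
      rcases he with rfl | he
      · exact absurd hF heF
      · obtain ⟨a, ha, b, hb, q, hq, hl, hqF, hqp⟩ :=
          ih hp.of_cons (hFS _ hF w (by simp)) hy he
        exact ⟨a, ha, b, hb, q, hq, hl, hqF, fun e he => by simp [hqp he]⟩
    · obtain ⟨z, hz, q, r, rfl, hq⟩ := p.exists_append_avoiding F S hFS hy
      refine ⟨u, hx, z, hz, .cons hadj q, ?_, by simp, fun e he => ?_, fun e he => ?_⟩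
      · rw [← Walk.cons_append] at hp
        exact hp.of_append_left
      · rw [Walk.edges_cons, List.mem_cons] at he
        rcases he with rfl | he
        exacts [hF, hq e he]
      · rw [Walk.edges_cons, List.mem_cons] at he
        rcases he with rfl | he <;> simp [*]

/-- Two vertices of a closed walk are joined by a path within it of at most half its length. -/
theorem Walk.exists_short_isPath {V : Type*} [DecidableEq V] {G : SimpleGraph V}
    {v x y : V} {c : G.Walk v v}
    (hx : x ∈ c.support) (hy : y ∈ c.support) :
    ∃ p : G.Walk x y, p.IsPath ∧ 2 * p.length ≤ c.length ∧ p.edges ⊆ c.edges := by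
  have hy' : y ∈ (c.rotate x hx).support := by
    rwa [Walk.mem_support_rotate_iff]
  have hlen : ((c.rotate x hx).takeUntil y hy').length +
      ((c.rotate x hx).dropUntil y hy').length = c.length := by
    rw [← Walk.length_append, Walk.take_spec, Walk.length_rotate]
  have hsub : (c.rotate x hx).edges ⊆ c.edges := fun e he => (c.rotate_edges x hx).mem_iff.mp he
  rcases le_total ((c.rotate x hx).takeUntil y hy').length
    ((c.rotate x hx).dropUntil y hy').length with h | h
  · refine ⟨_, Walk.bypass_isPath ((c.rotate x hx).takeUntil y hy'), ?_, ?_⟩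
    · have := Walk.length_bypass_le_length ((c.rotate x hx).takeUntil y hy')
      omega
    · exact fun e he => hsub (Walk.edges_takeUntil_subset_edges _ _
        (Walk.edges_bypass_subset_edges _ he))
  · refine ⟨_, Walk.bypass_isPath ((c.rotate x hx).dropUntil y hy').reverse, ?_, ?_⟩
    · have := Walk.length_bypass_le_length ((c.rotate x hx).dropUntil y hy').reverse
      rw [Walk.length_reverse] at this
      omega
    · intro e he
      have := Walk.edges_bypass_subset_edges _ he
      rw [Walk.edges_reverse, List.mem_reverse] at this
      exact hsub (Walk.edges_dropUntil_subset_edges _ _ this)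

/-- In a graph of girth at least `ℓ`, every cycle `C'` other than a cycle `C` of length at most
`1.01 * ℓ` contains a path of length about `ℓ / 4` which is edge-disjoint from `C`. -/
theorem exists_isPath_of_isCycleSet_ne {V : Type*} [DecidableEq V] {G : SimpleGraph V}
    {ℓ : ℕ} (hG : ∀ C, IsCycleSet G C → ℓ ≤ C.card)
    {C C' : Finset (Sym2 V)} (hC : IsCycleSet G C) (hC' : IsCycleSet G C') (hne : C' ≠ C)
    (hlen : 100 * C.card ≤ 101 * ℓ) :
    ∃ (x y : V) (q : G.Walk x y), q.IsPath ∧ q.length = (ℓ + 3) / 4 ∧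
      ∀ e ∈ q.edges, e ∈ C' ∧ e ∉ C := by
  suffices h : ∃ (x y : V) (q : G.Walk x y), q.IsPath ∧ ℓ ≤ 4 * q.length ∧
      ∀ e ∈ q.edges, e ∈ C' ∧ e ∉ C by
    obtain ⟨x, y, q, hq, hl, hqe⟩ := h
    refine ⟨x, _, q.take ((ℓ + 3) / 4), hq.take _, ?_, fun e he => hqe e ?_⟩
    · rw [Walk.take_length]
      omega
    · rw [Walk.edges_take] at he
      exact List.mem_of_mem_take he
  have hCℓ := hG C hC
  have hC'ℓ := hG C' hC'
  obtain ⟨u, c, hc, rfl⟩ := hC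
  obtain ⟨u', c', hc', rfl⟩ := hC'
  rw [hc.card_toFinset_edges] at hCℓ hlen
  rw [hc'.card_toFinset_edges] at hC'ℓ
  simp only [List.mem_toFinset]
  by_cases hdisj : ∀ e ∈ c'.edges, e ∉ c.edges
  · refine ⟨_, _, c'.tail, hc'.isPath_tail, ?_, fun e he => ?_⟩
    · have := Walk.length_tail_add_one hc'.not_nil
      have := hc'.three_le_length
      omega
    · have he' : e ∈ c'.edges := by
        rw [← Walk.cons_tail_eq c' hc'.not_nil, Walk.edges_cons]
        exact List.mem_cons_of_mem _ he
      exact ⟨he', hdisj e he'⟩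
  push Not at hdisj
  obtain ⟨f, hf', hf⟩ := hdisj
  obtain ⟨e, he', he⟩ : ∃ e ∈ c'.edges, e ∉ c.edges := by
    by_contra! hsub
    obtain ⟨g, hg, hg'⟩ : ∃ g ∈ c.edges, g ∉ c'.edges := by
      by_contra! hsub'
      exact hne (Finset.ext fun e => by
        simpa only [List.mem_toFinset] using ⟨hsub e, hsub' e⟩)
    induction g with | _ a b
    obtain ⟨p, hp, hpe⟩ := hc.exists_isPath_of_mem_edges_s16 hg
    refine hp.not_isCycle_edges_subset hc' fun e he => ?_
    rcases (hpe e).mp (hsub e he) with rfl | h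
    exacts [absurd he hg', h]
  induction f with | _ a b
  obtain ⟨p, hp, hpe⟩ := hc'.exists_isPath_of_mem_edges_s16 hf'
  have hep : e ∈ p.edges := ((hpe e).mp he').resolve_left (by rintro rfl; exact he hf)
  obtain ⟨x, hx, y, hy, q, hq, hq1, hqc, hqp⟩ := hp.exists_avoiding_subpath
    {e | e ∈ c.edges} {v | v ∈ c.support}
    (fun e he v hv => Walk.mem_support_of_mem_edges he hv)
    (c.snd_mem_support_of_mem_edges hf) (c.fst_mem_support_of_mem_edges hf) hep he
  refine ⟨x, y, q, hq, ?_, fun e he => ⟨(hpe e).mpr (.inr (hqp he)), hqc e he⟩⟩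
  obtain ⟨r, hr, hrl, hrc⟩ := Walk.exists_short_isPath hx hy
  have hqr : q ≠ r := by
    rintro rfl
    obtain ⟨e, he⟩ := List.exists_mem_of_length_pos (l := q.edges) (by
      rw [Walk.length_edges]; omega)
    exact hqc e he (hrc he)
  obtain ⟨D, hD, hDl⟩ := hq.exists_isCycleSet_s16 hr hqr
  have := hG D hD
  omega

end SimpleGraph

/-- Universal query sets: for all `m ≥ 2` and `ℓ ≥ 1` there exist `m^200` subsets of the label
set `{1, …, m}` (here `Fin m`) such that for every simple graph `G` on at most `2m` vertices
with exactly `m` edges injectively labelled by `Fin m` and no cycle of length strictly less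
than `ℓ`, every cycle of `G` of length at most `1.01·ℓ` is, for some index `i`, the unique
cycle of `G` whose label set is contained in `B i`. -/
theorem universal_query_sets (m ℓ : ℕ) (hm : 2 ≤ m) (hℓ : 1 ≤ ℓ) :
    ∃ B : Fin (m ^ 200) → Finset (Fin m),
      ∀ (V : Type) [Fintype V] [DecidableEq V] (G : SimpleGraph V) [DecidableRel G.Adj]
        (lab : Sym2 V → Fin m),
        Fintype.card V ≤ 2 * m →
        G.edgeFinset.card = m →
        Set.InjOn lab ↑G.edgeFinset →
        (∀ C : Finset (Sym2 V), IsCycleSet G C → ℓ ≤ C.card) →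
        ∀ C : Finset (Sym2 V), IsCycleSet G C → (C.card : ℝ) ≤ 1.01 * ℓ →
          ∃ i : Fin (m ^ 200),
            C.image lab ⊆ B i ∧
            ∀ C' : Finset (Sym2 V), IsCycleSet G C' → C' ≠ C → ¬ C'.image lab ⊆ B i := by
  obtain ⟨B, hB⟩ := exists_isolating_family m ℓ hm hℓ
  refine ⟨B, ?_⟩
  intro V _ _ G _ lab hV hE hlab hG C hC hClen
  classical
  have hinj : ∀ e ∈ G.edgeSet, ∀ f ∈ G.edgeSet, lab e = lab f → e = f := fun e he f hf h =>
    hlab (by simpa using he) (by simpa using hf) h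
  have hsub : ∀ D, IsCycleSet G D → ∀ e ∈ D, e ∈ G.edgeSet := by
    rintro _ ⟨u, c, -, rfl⟩ e he
    exact c.edges_subset_edgeSet (List.mem_toFinset.mp he)
  have hlen : 100 * C.card ≤ 101 * ℓ := by
    have : (100 * C.card : ℝ) ≤ 101 * ℓ := by linarith
    exact_mod_cast this
  have hℓ3 : 3 ≤ ℓ := by
    obtain ⟨u, c, hc, rfl⟩ := hC
    rw [hc.card_toFinset_edges] at hlen
    have := hc.three_le_length
    omega
  obtain ⟨φ⟩ : Nonempty (V ↪ Fin (2 * m)) :=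
    Function.Embedding.nonempty_of_card_le (by simpa using hV)
  let P : Fin (2 * m) × Fin (2 * m) → Finset (Fin m) := fun j =>
    Finset.univ.filter fun t => ∃ (x y : V) (p : G.Walk x y), φ x = j.1 ∧ φ y = j.2 ∧
      p.IsPath ∧ p.length = (ℓ + 3) / 4 ∧ ∃ e ∈ p.edges, lab e = t
  have hP : ∀ (x y : V) (q : G.Walk x y), q.IsPath → q.length = (ℓ + 3) / 4 →
      P (φ x, φ y) = q.edges.toFinset.image lab := by
    intro x y q hq hql
    ext t
    simp only [P, Finset.mem_filter, Finset.mem_univ, true_and, Finset.mem_image,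
      List.mem_toFinset]
    constructor
    · rintro ⟨x', y', p, hx, hy, hp, hpl, e, he, rfl⟩
      obtain rfl := φ.injective hx
      obtain rfl := φ.injective hy
      obtain rfl : p = q := by
        by_contra hne
        obtain ⟨D, hD, hDl⟩ := hp.exists_isCycleSet_s16 hq hne
        have := hG D hD
        omega
      exact ⟨e, he, rfl⟩
    · rintro ⟨e, he, rfl⟩
      exact ⟨x, y, q, rfl, rfl, hq, hql, e, he, rfl⟩
  obtain ⟨i, hCi, hi⟩ := hB (C.image lab) (Finset.card_image_le.trans (by omega)) P
  refine ⟨i, hCi, fun C' hC' hne hC'i => ?_⟩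
  obtain ⟨x, y, q, hq, hql, hqe⟩ :=
    SimpleGraph.exists_isPath_of_isCycleSet_ne hG hC hC' hne hlen
  refine hi (φ x, φ y) ?_ ?_ ?_ <;> rw [hP x y q hq hql]
  · rw [Finset.card_image_of_injOn, List.toFinset_card_of_nodup hq.isTrail.edges_nodup,
      SimpleGraph.Walk.length_edges, hql]
    · omega
    · intro e he f hf h
      exact hinj e (q.edges_subset_edgeSet (by simpa using he)) f
        (q.edges_subset_edgeSet (by simpa using hf)) h
  · rw [Finset.disjoint_left]
    intro t ht htC
    obtain ⟨e, he, rfl⟩ := Finset.mem_image.mp ht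
    obtain ⟨f, hf, hfe⟩ := Finset.mem_image.mp htC
    rw [List.mem_toFinset] at he
    obtain rfl := hinj f (hsub C hC f hf) e (q.edges_subset_edgeSet he) hfe
    exact (hqe f he).2 hf
  · intro t ht
    obtain ⟨e, he, rfl⟩ := Finset.mem_image.mp ht
    exact hC'i (Finset.mem_image_of_mem lab (hqe e (List.mem_toFinset.mp he)).1)
end
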